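/- arXiv:2206.07407 — 3 statements merged into one kernel-verified Lean document; each statement's English description precedes it below -/
import Mathlib

section
/- Let r ≥ 2 and let D = {z ∈ M_r(ℂ) : (z − z*)/(2i) is positive definite} (z* the conjugate transpose). For z, w ∈ D the matrix u(z,w) = (z − w*)/(2i) is invertible, and for an integer k ≥ 0 define the kernel K_k(z,w) : M_r(ℂ) → M_r(ℂ) by K_k(z,w)v = (det u(z,w))^{−k} · u(z,w)⁻¹ v u(z,w)⁻¹. Then K_k is positive definite — i.e. for every N, all z_1,…,z_N ∈ D and all v_1,…,v_N ∈ M_r(ℂ), the sum ∑_{i,j=1}^N tr(K_k(z_i,z_j) v_j (v_i)*) is a nonnegative real number — if and only if k ≥ 2. -/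
open Matrix
open scoped ComplexOrder

/-- `uKer r z w = (z - w*)/(2i)`. -/
noncomputable def uKer (r : ℕ) (z w : Matrix (Fin r) (Fin r) ℂ) :
    Matrix (Fin r) (Fin r) ℂ :=
  (2 * Complex.I)⁻¹ • (z - wᴴ)


open MeasureTheory in
theorem gK_int {b : ℂ} (hb : 0 < b.re) (g : ℂ → ℂ) (hg : Continuous g)
    (hg' : ∀ x, ‖g x‖ ≤ 1 + ‖x‖ ^ 2) :
    Integrable (fun x : ℂ => g x * Complex.exp (-b * (‖x‖ : ℂ) ^ 2)) := by
  have h1 : Integrable (fun x : ℂ => Complex.exp (-b * (‖x‖ : ℂ) ^ 2)) := by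
    simpa using GaussianFourier.integrable_cexp_neg_mul_sq_norm_add (V := ℂ) hb 0 0
  have hb2 : 0 < (((b.re / 2 : ℝ)) : ℂ).re := by simpa using hb
  have h2 : Integrable (fun x : ℂ => Complex.exp (-((b.re / 2 : ℝ) : ℂ) * (‖x‖ : ℂ) ^ 2)) := by
    simpa using GaussianFourier.integrable_cexp_neg_mul_sq_norm_add (V := ℂ) hb2 0 0
  refine (h1.norm.add (h2.norm.const_mul (2 / b.re))).mono'
    (by fun_prop) (Filter.Eventually.of_forall fun x => ?_)
  simp only [norm_mul, Complex.norm_exp, Pi.add_apply]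
  have e1 : (-b * (‖x‖ : ℂ) ^ 2).re = -b.re * ‖x‖ ^ 2 := by
    rw [← Complex.ofReal_pow, Complex.re_mul_ofReal, Complex.neg_re]
  have e2 : (-((b.re / 2 : ℝ) : ℂ) * (‖x‖ : ℂ) ^ 2).re = -(b.re / 2) * ‖x‖ ^ 2 := by
    rw [← Complex.ofReal_pow, Complex.re_mul_ofReal, Complex.neg_re, Complex.ofReal_re]
  rw [e1, e2]
  set t := ‖x‖ ^ 2
  have h3 : (b.re / 2) * t ≤ Real.exp ((b.re / 2) * t) := by
    linarith [Real.add_one_le_exp ((b.re / 2) * t)]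
  have h4 : Real.exp (-(b.re / 2) * t) = Real.exp (-b.re * t) * Real.exp ((b.re / 2) * t) := by
    rw [← Real.exp_add]; ring_nf
  have h5 : t * Real.exp (-b.re * t) ≤ 2 / b.re * Real.exp (-(b.re / 2) * t) := by
    rw [h4]
    have : t ≤ 2 / b.re * Real.exp ((b.re / 2) * t) := by
      rw [div_mul_eq_mul_div, le_div_iff₀ hb]; linarith
    nlinarith [Real.exp_pos (-b.re * t)]
  have := mul_le_mul_of_nonneg_right (hg' x) (Real.exp_pos (-b.re * t)).le
  linarith

open MeasureTheory in
theorem gK_m0 {b : ℂ} (hb : 0 < b.re) :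
    ∫ x : ℂ, Complex.exp (-b * (‖x‖ : ℂ) ^ 2) = Real.pi / b := by
  have := GaussianFourier.integral_cexp_neg_mul_sq_norm (V := ℂ) hb
  simpa using this

open MeasureTheory in
theorem gK_m1 {b : ℂ} :
    ∫ x : ℂ, x * Complex.exp (-b * (‖x‖ : ℂ) ^ 2) = 0 := by
  have h := integral_neg_eq_self (fun x : ℂ => x * Complex.exp (-b * (‖x‖ : ℂ) ^ 2)) volume
  simp only [norm_neg, neg_mul, integral_neg] at h
  simp only [neg_mul]
  exact self_eq_neg.mp h.symm

open MeasureTheory in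
theorem gK_m1' {b : ℂ} :
    ∫ x : ℂ, (starRingEnd ℂ) x * Complex.exp (-b * (‖x‖ : ℂ) ^ 2) = 0 := by
  have h := integral_neg_eq_self (fun x : ℂ => (starRingEnd ℂ) x * Complex.exp (-b * (‖x‖ : ℂ) ^ 2)) volume
  simp only [norm_neg, map_neg, neg_mul, integral_neg] at h
  simp only [neg_mul]
  exact self_eq_neg.mp h.symm

open MeasureTheory Filter Topology in
theorem gK_r3 {b : ℂ} (hb : 0 < b.re) :
    ∫ x in Set.Ioi (0 : ℝ), (x : ℂ) ^ 3 * Complex.exp (-b * (x : ℂ) ^ 2) = 1 / (2 * b ^ 2) := by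
  have hb0 : b ≠ 0 := by rintro rfl; simp at hb
  have hre : ∀ x : ℝ, ‖Complex.exp (-b * (x : ℂ) ^ 2)‖ = Real.exp (-b.re * x ^ 2) := by
    intro x
    rw [Complex.norm_exp, ← Complex.ofReal_pow, Complex.re_mul_ofReal, Complex.neg_re]
  have hint : IntegrableOn (fun x : ℝ => (x : ℂ) ^ 3 * Complex.exp (-b * (x : ℂ) ^ 2)) (Set.Ioi 0) := by
    have h := (integrable_rpow_mul_exp_neg_mul_sq hb (s := 3) (by norm_num)).integrableOn (s := Set.Ioi 0)
    refine h.norm.mono' (by fun_prop) (Eventually.of_forall fun x => ?_)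
    rw [norm_mul, hre, norm_mul, norm_pow, Complex.norm_real, Real.norm_eq_abs (Real.exp _), Real.abs_exp]
    have : x ^ (3:ℝ) = x ^ 3 := by exact_mod_cast Real.rpow_natCast x 3
    rw [this, norm_pow]
  have hd : ∀ x ∈ Set.Ici (0:ℝ), HasDerivAt (fun x : ℝ => -((x : ℂ) ^ 2 / (2 * b) + 1 / (2 * b ^ 2)) * Complex.exp (-b * (x : ℂ) ^ 2))
      ((x : ℂ) ^ 3 * Complex.exp (-b * (x : ℂ) ^ 2)) x := by
    intro x _
    have h0 : HasDerivAt (fun x : ℝ => (x : ℂ)) 1 x := Complex.ofRealCLM.hasDerivAt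
    have h1 := ((((h0.pow 2).div_const (2 * b)).add_const (1 / (2 * b ^ 2))).neg).mul
      (((h0.pow 2).const_mul (-b)).cexp)
    convert! h1 using 1
    simp
    field_simp
    ring
  have ht : Tendsto (fun x : ℝ => -((x : ℂ) ^ 2 / (2 * b) + 1 / (2 * b ^ 2)) * Complex.exp (-b * (x : ℂ) ^ 2)) atTop (𝓝 0) := by
    have k2 : ∀ s : ℝ, Tendsto (fun x : ℝ => x ^ s * Real.exp (-b.re * x ^ 2)) atTop (𝓝 0) := by
      intro s
      have := (rpow_mul_exp_neg_mul_sq_isLittleO_exp_neg hb s)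
      refine this.trans_tendsto ?_
      have : Tendsto (fun x : ℝ => -(1/2:ℝ) * x) atTop atBot :=
        (tendsto_id (α := ℝ)).const_mul_atTop_of_neg (by norm_num)
      exact Real.tendsto_exp_atBot.comp this
    have k3 := ((k2 2).const_mul ‖1 / (2 * b)‖).add ((k2 0).const_mul ‖1 / (2 * b ^ 2)‖)
    simp only [mul_zero, add_zero] at k3
    refine squeeze_zero_norm (fun x => ?_) k3
    rw [norm_mul, hre, norm_neg, Real.rpow_zero, Real.rpow_two]
    have : ‖(x : ℂ) ^ 2 / (2 * b) + 1 / (2 * b ^ 2)‖ ≤ ‖1 / (2 * b)‖ * x ^ 2 + ‖1 / (2 * b ^ 2)‖ := by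
      refine (norm_add_le _ _).trans ?_
      rw [div_eq_mul_one_div, norm_mul, norm_pow, Complex.norm_real, Real.norm_eq_abs, sq_abs, mul_comm]
    calc _ ≤ _ := mul_le_mul_of_nonneg_right this (Real.exp_pos _).le
      _ = _ := by ring
  rw [integral_Ioi_of_hasDerivAt_of_tendsto' hd hint ht]
  simp

open MeasureTheory in
theorem gK_m2 {b : ℂ} (hb : 0 < b.re) :
    ∫ x : ℂ, (x * (starRingEnd ℂ) x) * Complex.exp (-b * (‖x‖ : ℂ) ^ 2) = Real.pi / b * b⁻¹ := by
  have hb0 : b ≠ 0 := by rintro rfl; simp at hb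
  calc
    _ = ∫ x in Set.Ioi (0 : ℝ) ×ˢ Set.Ioo (-Real.pi) Real.pi,
        ((x.1 : ℂ) ^ 3 * Complex.exp (-b * (x.1 : ℂ) ^ 2)) * 1 := by
      rw [← Complex.integral_comp_polarCoord_symm, polarCoord_target]
      refine setIntegral_congr_fun (measurableSet_Ioi.prod measurableSet_Ioo) fun x hx => ?_
      have hx1 : 0 < x.1 := hx.1
      simp only [Complex.mul_conj, Complex.normSq_eq_norm_sq, Complex.norm_polarCoord_symm, abs_of_pos hx1]
      rw [Complex.real_smul]; push_cast; ring
    _ = (∫ x in Set.Ioi (0 : ℝ), (x : ℂ) ^ 3 * Complex.exp (-b * (x : ℂ) ^ 2)) * ∫ _ in Set.Ioo (-Real.pi) Real.pi, (1:ℂ) := by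
      rw [← setIntegral_prod_mul, Measure.volume_eq_prod]
    _ = _ := by
      rw [gK_r3 hb]
      simp [Real.pi_pos.le]
      field_simp
      have : Real.pi + Real.pi = 2 * Real.pi := by ring
      norm_num [max_eq_left, Real.pi_pos.le]
      try ring

theorem gK_spec {r : ℕ} (A : Matrix (Fin r) (Fin r) ℂ) (hA : A.IsHermitian) :
    ∃ (V : Matrix (Fin r) (Fin r) ℂ) (l : Fin r → ℝ), V * Vᴴ = 1 ∧
      A = V * diagonal (fun i => (l i : ℂ)) * Vᴴ ∧ (A.PosDef → ∀ i, 0 < l i) := by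
  refine ⟨hA.eigenvectorUnitary, hA.eigenvalues, ?_, ?_, fun h i => h.eigenvalues_pos i⟩
  · have := (Matrix.mem_unitaryGroup_iff).1 hA.eigenvectorUnitary.2
    simpa [star_eq_conjTranspose] using this
  · have h1 := hA.spectral_theorem
    rw [Unitary.conjStarAlgAut_apply] at h1
    exact h1

theorem gK_fact {r : ℕ} (u : Matrix (Fin r) (Fin r) ℂ) (hu : (u + uᴴ).PosDef) :
    ∃ (q : Matrix (Fin r) (Fin r) ℂ) (D : Fin r → ℂ), IsUnit q ∧ (∀ i, 0 < (D i).re) ∧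
      u = q * diagonal D * qᴴ := by
  have hh : ((1/2 : ℂ) • (u + uᴴ)).PosDef := hu.smul (by norm_num)
  obtain ⟨p, hp, hpe⟩ : ∃ p : Matrix (Fin r) (Fin r) ℂ, IsUnit p ∧ (1/2 : ℂ) • (u + uᴴ) = p * pᴴ := by
    obtain ⟨V, l, hV, hVe, hl⟩ := gK_spec _ hh.isHermitian
    have hVu : IsUnit V := IsUnit.of_mul_eq_one _ hV
    have hl := hl hh
    refine ⟨V * diagonal (fun i => ((Real.sqrt (l i) : ℝ) : ℂ)), ?_, ?_⟩
    · refine hVu.mul ?_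
      rw [Matrix.isUnit_diagonal, Pi.isUnit_iff]
      intro i
      simpa using Real.sqrt_ne_zero'.2 (hl i)
    · rw [hVe, conjTranspose_mul, diagonal_conjTranspose]
      rw [Matrix.mul_assoc V (diagonal _) (_ * _), ← Matrix.mul_assoc (diagonal _) (diagonal _), diagonal_mul_diagonal,
        ← Matrix.mul_assoc]
      congr 3
      ext i
      have := Real.mul_self_sqrt (hl i).le
      simp only [Pi.star_apply, RCLike.star_def, Complex.conj_ofReal]
      rw [← Complex.ofReal_mul, this]
  have hpd : IsUnit p.det := (Matrix.isUnit_iff_isUnit_det p).1 hp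
  have hpd' : IsUnit pᴴ.det := by rw [det_conjTranspose]; exact hpd.star
  have hs : (p⁻¹ * ((-Complex.I / 2) • (u - uᴴ)) * (p⁻¹)ᴴ).IsHermitian := by
    apply isHermitian_mul_mul_conjTranspose
    ext i j
    simp [Matrix.conjTranspose_apply]
    ring
  obtain ⟨V, l, hV, h1, -⟩ := gK_spec _ hs
  have hVu : IsUnit V := IsUnit.of_mul_eq_one _ hV
  refine ⟨p * V, fun i => 1 + Complex.I * (l i : ℂ), hp.mul hVu, by simp, ?_⟩
  have e1 : diagonal (fun i => 1 + Complex.I * (l i : ℂ)) =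
      1 + Complex.I • diagonal (fun i => (l i : ℂ)) := by
    ext i j
    by_cases h : i = j
    · subst h; simp
    · simp [h]
  have e2 : V * diagonal (fun i => 1 + Complex.I * (l i : ℂ)) * Vᴴ = 1 +
      Complex.I • (p⁻¹ * ((-Complex.I / 2) • (u - uᴴ)) * (p⁻¹)ᴴ) := by
    rw [h1, e1, Matrix.mul_add, Matrix.add_mul, Matrix.mul_one, hV, Matrix.mul_smul, Matrix.smul_mul]
  have e3 : p * V * diagonal (fun i => 1 + Complex.I * (l i : ℂ)) * (p * V)ᴴ =
      p * (V * diagonal (fun i => 1 + Complex.I * (l i : ℂ)) * Vᴴ) * pᴴ := by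
    rw [conjTranspose_mul]; simp only [Matrix.mul_assoc]
  rw [e3, e2, Matrix.mul_add, Matrix.add_mul, Matrix.mul_one, ← hpe, Matrix.mul_smul, Matrix.smul_mul]
  have e4 : p * (p⁻¹ * ((-Complex.I / 2) • (u - uᴴ)) * (p⁻¹)ᴴ) * pᴴ = (-Complex.I / 2) • (u - uᴴ) := by
    rw [conjTranspose_nonsing_inv, Matrix.mul_assoc p⁻¹, Matrix.mul_nonsing_inv_cancel_left _ _ hpd,
      Matrix.nonsing_inv_mul_cancel_right _ _ hpd']
  rw [e4, smul_smul]
  have : Complex.I * (-Complex.I / 2) = 1 / 2 := by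
    rw [mul_div_assoc', mul_neg, Complex.I_mul_I, neg_neg]
  rw [this]
  ext i j
  simp
  ring

open MeasureTheory in
theorem gK_diag0 {r : ℕ} (D : Fin r → ℂ) (hD : ∀ i, 0 < (D i).re) :
    Integrable (fun x : Fin r → ℂ => ∏ i, Complex.exp (-(D i) * (‖x i‖ : ℂ) ^ 2)) ∧
    ∫ x : Fin r → ℂ, ∏ i, Complex.exp (-(D i) * (‖x i‖ : ℂ) ^ 2) = Real.pi ^ r * (∏ i, D i)⁻¹ := by
  constructor
  · exact Integrable.fintype_prod (f := fun i (x : ℂ) => Complex.exp (-(D i) * (‖x‖ : ℂ) ^ 2))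
      fun i => by simpa using gK_int (hD i) (fun _ => 1) (by fun_prop) (by intro x; simp)
  · rw [integral_fintype_prod_volume_eq_prod (fun i (x : ℂ) => Complex.exp (-(D i) * (‖x‖ : ℂ) ^ 2))]
    simp_rw [fun i => gK_m0 (hD i)]
    rw [Finset.prod_div_distrib]; simp [div_eq_mul_inv]

open MeasureTheory in
theorem gK_diag2 {r : ℕ} (D : Fin r → ℂ) (hD : ∀ i, 0 < (D i).re) (p q : Fin r) :
    Integrable (fun x : Fin r → ℂ => x p * (starRingEnd ℂ) (x q) * ∏ i, Complex.exp (-(D i) * (‖x i‖ : ℂ) ^ 2)) ∧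
    ∫ x : Fin r → ℂ, x p * (starRingEnd ℂ) (x q) * ∏ i, Complex.exp (-(D i) * (‖x i‖ : ℂ) ^ 2) =
      Real.pi ^ r * (∏ i, D i)⁻¹ * (diagonal D)⁻¹ p q := by
  have hD0 : ∀ i, D i ≠ 0 := fun i h => by have := hD i; simp [h] at this
  let f : Fin r → ℂ → ℂ := fun i x =>
    ((if i = p then x else 1) * (if i = q then (starRingEnd ℂ) x else 1)) * Complex.exp (-(D i) * (‖x‖ : ℂ) ^ 2)
  have hf : ∀ x : Fin r → ℂ, x p * (starRingEnd ℂ) (x q) * ∏ i, Complex.exp (-(D i) * (‖x i‖ : ℂ) ^ 2) = ∏ i, f i (x i) := by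
    intro x
    simp only [f, Finset.prod_mul_distrib]
    simp
  simp_rw [hf]
  constructor
  · refine Integrable.fintype_prod (f := f) fun i => ?_
    refine gK_int (hD i) _ ?_ ?_
    · split_ifs <;> fun_prop
    · intro x
      split_ifs <;> simp <;> nlinarith [norm_nonneg x, sq_nonneg (‖x‖ - 1)]
  · rw [integral_fintype_prod_volume_eq_prod f]
    have hinv : (diagonal D)⁻¹ = diagonal (fun i => (D i)⁻¹) := by
      apply Matrix.inv_eq_right_inv
      rw [diagonal_mul_diagonal]
      simp [hD0]
    rw [hinv]
    by_cases h : p = q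
    · subst h
      have : ∀ i, ∫ x, f i x = (Real.pi / D i) * (if i = p then (D p)⁻¹ else 1) := by
        intro i
        by_cases hi : i = p
        · subst hi
          simpa [f] using gK_m2 (hD i)
        · simpa [f, hi] using gK_m0 (hD i)
      simp_rw [this]
      rw [Finset.prod_mul_distrib, Finset.prod_div_distrib]; simp [div_eq_mul_inv]
    · rw [diagonal_apply_ne _ h, mul_zero]
      refine Finset.prod_eq_zero (Finset.mem_univ p) ?_
      simpa [f, h] using gK_m1 (b := D p)

open MeasureTheory in
theorem gK_cov {r : ℕ} (B : Matrix (Fin r) (Fin r) ℂ) (hB : IsUnit B) (F : (Fin r → ℂ) → ℂ) (c : ℂ)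
    (h : Integrable (fun x => F (B *ᵥ x)) ∧ ∫ x, F (B *ᵥ x) = c) :
    Integrable F ∧ ∫ x, F x = (B.det * star B.det) * c := by
  have hBd : B.det ≠ 0 := ((Matrix.isUnit_iff_isUnit_det B).1 hB).ne_zero
  let L : (Fin r → ℂ) →ₗ[ℝ] (Fin r → ℂ) := (Matrix.toLin' B).restrictScalars ℝ
  have hL : LinearMap.det L = Complex.normSq B.det := by
    rw [LinearMap.det_restrictScalars, Algebra.norm_complex_apply, LinearMap.det_toLin']
  have hpos : 0 < Complex.normSq B.det := Complex.normSq_pos.2 hBd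
  have hmap := Measure.map_linearMap_addHaar_eq_smul_addHaar (volume : Measure (Fin r → ℂ)) (f := L)
    (by rw [hL]; exact hpos.ne')
  let e : (Fin r → ℂ) ≃L[ℝ] (Fin r → ℂ) := 
    (LinearEquiv.ofIsUnitDet (f := L) (v := Module.finBasis ℝ _) (v' := Module.finBasis ℝ _)
      (by rw [LinearMap.det_toMatrix, hL]; exact hpos.ne'.isUnit)).toContinuousLinearEquiv
  have heq : ∀ x, e x = B *ᵥ x := fun x => by
    change L x = _
    simp [L]
  have hemb : MeasurableEmbedding (L : (Fin r → ℂ) → (Fin r → ℂ)) := by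
    have : (L : (Fin r → ℂ) → (Fin r → ℂ)) = e := rfl
    rw [this]
    exact e.toHomeomorph.measurableEmbedding
  have hL' : ∀ x, L x = B *ᵥ x := heq
  rw [hL, abs_of_pos (inv_pos.2 hpos)] at hmap
  have h0 : ENNReal.ofReal (Complex.normSq B.det)⁻¹ ≠ 0 := by simpa using hpos
  have hi : Integrable F := by
    have := (hemb.integrable_map_iff (g := F) (μ := volume)).2 (by simpa [Function.comp_def, hL'] using h.1)
    rw [hmap] at this
    exact (integrable_smul_measure h0 ENNReal.ofReal_ne_top).1 this
  refine ⟨hi, ?_⟩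
  have h2 := hemb.integral_map F (μ := volume)
  rw [hmap, integral_smul_measure] at h2
  simp_rw [hL'] at h2
  rw [h.2, ENNReal.toReal_ofReal (inv_pos.2 hpos).le, Complex.real_smul] at h2
  rw [← h2, RCLike.star_def, Complex.mul_conj, Complex.ofReal_inv, mul_inv_cancel_left₀]
  exact_mod_cast hpos.ne'

open MeasureTheory in
theorem gK_main {r : ℕ} (u : Matrix (Fin r) (Fin r) ℂ) (hu : (u + uᴴ).PosDef) :
    IsUnit u ∧
    (Integrable (fun x : Fin r → ℂ => Complex.exp (-(star x ⬝ᵥ u *ᵥ x))) ∧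
      ∫ x : Fin r → ℂ, Complex.exp (-(star x ⬝ᵥ u *ᵥ x)) = Real.pi ^ r * u.det⁻¹) ∧
    ∀ p q, (Integrable (fun x : Fin r → ℂ => x p * (starRingEnd ℂ) (x q) * Complex.exp (-(star x ⬝ᵥ u *ᵥ x))) ∧
      ∫ x : Fin r → ℂ, x p * (starRingEnd ℂ) (x q) * Complex.exp (-(star x ⬝ᵥ u *ᵥ x)) =
        Real.pi ^ r * u.det⁻¹ * u⁻¹ p q) := by
  obtain ⟨q, D, hq, hD, rfl⟩ := gK_fact u hu
  have hD0 : ∀ i, D i ≠ 0 := fun i h => by have := hD i; simp [h] at this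
  have hqd : IsUnit q.det := (Matrix.isUnit_iff_isUnit_det q).1 hq
  have hqd' : IsUnit qᴴ.det := by rw [det_conjTranspose]; exact hqd.star
  have hqs : IsUnit qᴴ := (Matrix.isUnit_iff_isUnit_det _).2 hqd'
  set B := (qᴴ)⁻¹ with hBdef
  have hB : IsUnit B := by rw [hBdef]; exact (Matrix.isUnit_nonsing_inv_iff).2 hqs
  have hBH : Bᴴ = q⁻¹ := by rw [hBdef, ← conjTranspose_nonsing_inv, conjTranspose_conjTranspose]
  have hDu : IsUnit (diagonal D) := by
    rw [Matrix.isUnit_diagonal, Pi.isUnit_iff]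
    intro i; exact (hD0 i).isUnit
  have hBuB : Bᴴ * (q * diagonal D * qᴴ) * B = diagonal D := by
    rw [hBH, Matrix.mul_assoc q, Matrix.nonsing_inv_mul_cancel_left _ _ hqd, hBdef,
      Matrix.mul_nonsing_inv_cancel_right _ _ hqd']
  have hexp : ∀ x : Fin r → ℂ, Complex.exp (-(star (B *ᵥ x) ⬝ᵥ (q * diagonal D * qᴴ) *ᵥ (B *ᵥ x))) =
      ∏ i, Complex.exp (-(D i) * (‖x i‖ : ℂ) ^ 2) := by
    intro x
    rw [← Complex.exp_sum, star_mulVec, mulVec_mulVec, ← dotProduct_mulVec, mulVec_mulVec,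
      ← Matrix.mul_assoc, hBuB]
    congr 1
    simp only [dotProduct, mulVec_diagonal, ← Finset.sum_neg_distrib]
    refine Finset.sum_congr rfl fun i _ => ?_
    have := Complex.mul_conj (x i)
    rw [Complex.normSq_eq_norm_sq] at this
    push_cast at this
    rw [← this]
    simp
    ring
  have hdet : (B.det * star B.det) * (Real.pi ^ r * (∏ i, D i)⁻¹) =
      Real.pi ^ r * (q * diagonal D * qᴴ).det⁻¹ := by
    have h1 : B.det = (star q.det)⁻¹ := by
      rw [hBdef, det_nonsing_inv, Ring.inverse_eq_inv', det_conjTranspose]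
    rw [h1, star_inv₀, star_star, det_mul, det_mul, det_diagonal, det_conjTranspose, mul_inv, mul_inv]
    ring
  have hinv : (q * diagonal D * qᴴ)⁻¹ = B * (diagonal D)⁻¹ * Bᴴ := by
    rw [Matrix.mul_inv_rev, Matrix.mul_inv_rev, hBH, Matrix.mul_assoc]
  refine ⟨(hq.mul hDu).mul hqs, ?_, fun p s => ?_⟩
  · rw [← hdet]
    apply gK_cov B hB
    simp_rw [hexp]
    exact gK_diag0 D hD
  · rw [← hdet, mul_assoc (B.det * star B.det)]
    apply gK_cov B hB
    have hx : ∀ x : Fin r → ℂ, (B *ᵥ x) p * (starRingEnd ℂ) ((B *ᵥ x) s) *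
        Complex.exp (-(star (B *ᵥ x) ⬝ᵥ (q * diagonal D * qᴴ) *ᵥ (B *ᵥ x))) =
        ∑ a, ∑ b, (B p a * star (B s b)) * (x a * (starRingEnd ℂ) (x b) * ∏ i, Complex.exp (-(D i) * (‖x i‖ : ℂ) ^ 2)) := by
      intro x
      rw [hexp, mulVec, mulVec, dotProduct, dotProduct, map_sum, Finset.sum_mul_sum, Finset.sum_mul]
      refine Finset.sum_congr rfl fun a _ => ?_
      rw [Finset.sum_mul]
      refine Finset.sum_congr rfl fun b _ => ?_
      rw [map_mul, RCLike.star_def]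
      ring
    simp_rw [hx]
    have hI := fun a b => (gK_diag2 D hD a b).1
    refine ⟨integrable_finsetSum _ fun a _ => integrable_finsetSum _ fun b _ => (hI a b).const_mul _, ?_⟩
    rw [integral_finsetSum _ fun a _ => integrable_finsetSum _ fun b _ => (hI a b).const_mul _]
    simp_rw [integral_finsetSum _ fun b _ => (hI _ b).const_mul _, integral_const_mul, fun a b => (gK_diag2 D hD a b).2]
    rw [hinv, Matrix.mul_apply, Finset.mul_sum]
    simp_rw [Matrix.mul_apply, Finset.sum_mul, Finset.mul_sum]
    rw [Finset.sum_comm]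
    refine Finset.sum_congr rfl fun a _ => Finset.sum_congr rfl fun b _ => ?_
    rw [conjTranspose_apply]
    ring

open MeasureTheory in
theorem gK_gram {ι X : Type*} [Fintype ι] [MeasurableSpace X] (μ : Measure X) (g : ι → X → ℂ) (c : ℝ)
    (hc : 0 < c)
    (M : Matrix ι ι ℂ)
    (h : ∀ a b, Integrable (fun x => g a x * (starRingEnd ℂ) (g b x)) μ ∧
      ∫ x, g a x * (starRingEnd ℂ) (g b x) ∂μ = c * M a b) : M.PosSemidef := by
  have hc' : (c : ℂ) ≠ 0 := by exact_mod_cast hc.ne'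
  refine PosSemidef.of_dotProduct_mulVec_nonneg ?_ ?_
  · ext a b
    apply mul_left_cancel₀ hc'
    rw [conjTranspose_apply, ← (h a b).2, ← Complex.conj_ofReal c, RCLike.star_def, ← map_mul, ← (h b a).2,
      ← integral_conj]
    simp [mul_comm]
  · intro v
    have key : star v ⬝ᵥ M *ᵥ v = ((c⁻¹ * ∫ x, ‖∑ a, star (v a) * g a x‖ ^ 2 ∂μ : ℝ) : ℂ) := by
      push_cast
      rw [eq_inv_mul_iff_mul_eq₀ hc', ← integral_complex_ofReal]
      have : ∀ x, ((‖∑ a, star (v a) * g a x‖ ^ 2 : ℝ) : ℂ) =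
          ∑ a, ∑ b, (star (v a) * v b) * (g a x * (starRingEnd ℂ) (g b x)) := by
        intro x
        rw [← Complex.normSq_eq_norm_sq, ← Complex.mul_conj, map_sum, Finset.sum_mul_sum]
        refine Finset.sum_congr rfl fun a _ => Finset.sum_congr rfl fun b _ => ?_
        simp
        ring
      simp_rw [this]
      rw [integral_finsetSum _ fun a _ => integrable_finsetSum _ fun b _ => (h a b).1.const_mul _]
      simp_rw [integral_finsetSum _ fun b _ => (h _ b).1.const_mul _, integral_const_mul, fun a b => (h a b).2]
      simp only [dotProduct, mulVec, Finset.mul_sum]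
      refine Finset.sum_congr rfl fun a _ => Finset.sum_congr rfl fun b _ => ?_
      simp
      ring
    rw [key]
    rw [Complex.zero_le_real]
    exact mul_nonneg (inv_pos.2 hc).le (integral_nonneg fun x => by positivity)

theorem gK_herm {r : ℕ} {z w : Matrix (Fin r) (Fin r) ℂ} (hz : (uKer r z z).PosDef)
    (hw : (uKer r w w).PosDef) : (uKer r z w + (uKer r z w)ᴴ).PosDef := by
  have : uKer r z w + (uKer r z w)ᴴ = uKer r z z + uKer r w w := by
    ext i j
    simp [uKer]
    ring
  rw [this]
  exact hz.add hw

theorem gK_exp {r : ℕ} (z w : Matrix (Fin r) (Fin r) ℂ) (x : Fin r → ℂ) :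
    Complex.exp (Complex.I / 2 * (star x ⬝ᵥ z *ᵥ x)) *
      (starRingEnd ℂ) (Complex.exp (Complex.I / 2 * (star x ⬝ᵥ w *ᵥ x))) =
    Complex.exp (-(star x ⬝ᵥ uKer r z w *ᵥ x)) := by
  rw [← Complex.exp_conj, ← Complex.exp_add]
  congr 1
  have h : (starRingEnd ℂ) (star x ⬝ᵥ w *ᵥ x) = star x ⬝ᵥ wᴴ *ᵥ x := by
    rw [← RCLike.star_def, ← star_dotProduct_star, star_star, star_mulVec, dotProduct_comm,
      dotProduct_mulVec, dotProduct_comm]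
  rw [map_mul, h, uKer, smul_mulVec, sub_mulVec, dotProduct_smul, dotProduct_sub, smul_eq_mul]
  have h2 : (starRingEnd ℂ) 2 = 2 := map_ofNat _ 2
  simp [h2]
  ring

theorem gK_suff (r N k : ℕ) (hk : 2 ≤ k) (z : Fin N → Matrix (Fin r) (Fin r) ℂ)
    (hz : ∀ i, (uKer r (z i) (z i)).PosDef) (v : Fin N → Matrix (Fin r) (Fin r) ℂ) :
    0 ≤ ∑ i, ∑ j,
          ((uKer r (z i) (z j)).det ^ (-(k : ℤ)) •
            ((uKer r (z i) (z j))⁻¹ * v j * (uKer r (z i) (z j))⁻¹ * (v i)ᴴ)).trace := by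
  have hm := fun i j => gK_main _ (gK_herm (hz i) (hz j))
  have hpi : 0 < Real.pi ^ r := by positivity
  let f : Fin N → (Fin r → ℂ) → ℂ := fun i x => Complex.exp (Complex.I / 2 * (star x ⬝ᵥ z i *ᵥ x))
  have hf : ∀ i j x, f i x * (starRingEnd ℂ) (f j x) = Complex.exp (-(star x ⬝ᵥ uKer r (z i) (z j) *ᵥ x)) :=
    fun i j x => gK_exp _ _ x
  let M0 : Matrix (Fin N) (Fin N) ℂ := of fun i j => (uKer r (z i) (z j)).det⁻¹
  let M1 : Matrix (Fin N × Fin r) (Fin N × Fin r) ℂ := of fun a b =>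
    (uKer r (z a.1) (z b.1)).det⁻¹ * (uKer r (z a.1) (z b.1))⁻¹ a.2 b.2
  let M2 : Matrix (Fin N × Fin r) (Fin N × Fin r) ℂ := of fun a b =>
    (uKer r (z a.1) (z b.1)).det⁻¹ * (uKer r (z a.1) (z b.1))⁻¹ b.2 a.2
  have h0 : M0.PosSemidef := by
    refine gK_gram MeasureTheory.volume f _ hpi M0 fun i j => ?_
    simp_rw [hf]
    push_cast
    exact (hm i j).2.1
  have h1 : M1.PosSemidef := by
    refine gK_gram MeasureTheory.volume (fun a x => x a.2 * f a.1 x) _ hpi M1 fun a b => ?_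
    have : ∀ x : Fin r → ℂ, x a.2 * f a.1 x * (starRingEnd ℂ) (x b.2 * f b.1 x) =
        x a.2 * (starRingEnd ℂ) (x b.2) * Complex.exp (-(star x ⬝ᵥ uKer r (z a.1) (z b.1) *ᵥ x)) := by
      intro x
      rw [← hf, map_mul]; ring
    simp_rw [this]
    have := (hm a.1 b.1).2.2 a.2 b.2
    push_cast
    rw [mul_assoc] at this
    exact this
  have h2 : M2.PosSemidef := by
    refine gK_gram MeasureTheory.volume (fun a x => (starRingEnd ℂ) (x a.2) * f a.1 x) _ hpi M2 fun a b => ?_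
    have : ∀ x : Fin r → ℂ, (starRingEnd ℂ) (x a.2) * f a.1 x * (starRingEnd ℂ) ((starRingEnd ℂ) (x b.2) * f b.1 x) =
        x b.2 * (starRingEnd ℂ) (x a.2) * Complex.exp (-(star x ⬝ᵥ uKer r (z a.1) (z b.1) *ᵥ x)) := by
      intro x
      rw [← hf, map_mul, Complex.conj_conj]; ring
    simp_rw [this]
    have := (hm a.1 b.1).2.2 b.2 a.2
    push_cast
    rw [mul_assoc] at this
    exact this
  have h0k : ∀ n : ℕ, (of fun i j => (M0 i j) ^ n : Matrix (Fin N) (Fin N) ℂ).PosSemidef := by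
    intro n
    induction n with
    | zero =>
      have := posSemidef_vecMulVec_self_star (fun _ : Fin N => (1 : ℂ))
      convert this using 1
      ext i j
      simp [vecMulVec]
    | succ n ih =>
      have := ih.hadamard h0
      have e : (of fun i j => (M0 i j) ^ (n + 1) : Matrix (Fin N) (Fin N) ℂ) =
          (of fun i j => (M0 i j) ^ n : Matrix (Fin N) (Fin N) ℂ) ⊙ M0 := by
        ext i j
        rw [hadamard_apply, of_apply, of_apply, pow_succ]
      rw [e]
      exact this
  obtain ⟨n, rfl⟩ := Nat.exists_eq_add_of_le hk
  have hW := (((h0k n).submatrix (fun a : Fin N × Fin r × Fin r => a.1)).hadamard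
    (h1.submatrix (fun a : Fin N × Fin r × Fin r => (a.1, a.2.1)))).hadamard
    (h2.submatrix (fun a : Fin N × Fin r × Fin r => (a.1, a.2.2)))
  have := hW.dotProduct_mulVec_nonneg (fun a => v a.1 a.2.1 a.2.2)
  refine this.trans_eq ?_
  simp only [dotProduct, mulVec, Fintype.sum_prod_type, Finset.mul_sum]
  refine Finset.sum_congr rfl fun i _ => ?_
  simp_rw [Finset.sum_comm (s := (Finset.univ : Finset (Fin r))) (t := (Finset.univ : Finset (Fin N)))]
  refine Finset.sum_congr rfl fun j _ => ?_
  simp only [trace, diag, Matrix.smul_apply, Matrix.mul_apply, conjTranspose_apply, Finset.sum_mul, smul_eq_mul, Finset.mul_sum]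
  refine Finset.sum_congr rfl fun p _ => ?_
  refine Finset.sum_congr rfl fun t _ => ?_
  rw [Finset.sum_comm]
  refine Finset.sum_congr rfl fun s _ => ?_
  refine Finset.sum_congr rfl fun q _ => ?_
  simp only [hadamard_apply, submatrix_apply, of_apply, M0, M1, M2, Pi.star_apply]
  rw [_root_.zpow_neg, _root_.zpow_natCast, _root_.pow_add, _root_.mul_inv, _root_.inv_pow]
  ring

noncomputable def gKY : Fin 5 → Matrix (Fin 2) (Fin 2) ℂ :=
  ![!![1,0;0,1], !![3,0;0,1], !![1,0;0,3], !![1,1;0,1], !![1,0;1,1]]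
noncomputable def gKV (c : ℂ) : Fin 5 → Matrix (Fin 2) (Fin 2) ℂ :=
  ![!![-1,1;1,-1], !![0,0;0,c], !![c,0;0,0], !![-1/2,-1;-1/4,-1/2], !![-1/2,-1/4;-1,-1/2]]

theorem gK_ct (a b c d : ℂ) : (!![a, b; c, d])ᴴ = !![star a, star c; star b, star d] := by
  ext i j; fin_cases i <;> fin_cases j <;> rfl

theorem gK_3 : (starRingEnd ℂ) 3 = 3 := map_ofNat _ 3

theorem gK_Ysum (i j : Fin 5) : ∀ M : Matrix (Fin 2) (Fin 2) ℂ, M = (1/2 : ℂ) • (gKY i + (gKY j)ᴴ) →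
    M.det ≠ 0 := by
  rintro M rfl
  fin_cases i <;> fin_cases j <;> simp [gKY, det_fin_two] <;> norm_num

theorem gK_Ypd (i : Fin 5) : ((1/2 : ℂ) • (gKY i + (gKY i)ᴴ)).PosDef := by
  refine PosDef.of_dotProduct_mulVec_pos ?_ ?_
  · ext a b
    simp [add_comm]
    ring
  · intro x hx
    have hx' : 0 < Complex.normSq (x 0) + Complex.normSq (x 1) := by
      by_contra h
      have h0 := Complex.normSq_nonneg (x 0)
      have h1 := Complex.normSq_nonneg (x 1)
      apply hx
      ext a
      fin_cases a
      · exact Complex.normSq_eq_zero.1 (show Complex.normSq (x 0) = 0 by linarith)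
      · exact Complex.normSq_eq_zero.1 (show Complex.normSq (x 1) = 0 by linarith)
    simp only [Complex.normSq_apply] at hx'
    rw [Complex.lt_def]
    fin_cases i <;> simp [gKY, dotProduct, mulVec, Fin.sum_univ_two] <;> constructor <;>
      nlinarith [sq_nonneg ((x 0).re + (x 1).re), sq_nonneg ((x 0).im + (x 1).im)]

theorem gK_neg2 (k : ℕ) (hk : k < 2) :
    ∑ i, ∑ j, (((1/2 : ℂ) • (gKY i + (gKY j)ᴴ)).det ^ (-(k : ℤ)) •
            (((1/2 : ℂ) • (gKY i + (gKY j)ᴴ))⁻¹ * gKV (2 ^ k) j * ((1/2 : ℂ) • (gKY i + (gKY j)ᴴ))⁻¹ * (gKV (2 ^ k) i)ᴴ)).trace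
       = if k = 0 then -2 else -2/3 := by
  interval_cases k
  · simp [Fin.sum_univ_five, gKY, gKV, trace_fin_two, inv_def, gK_ct, gK_3, adjugate_fin_two, det_fin_two]
    norm_num
  · simp [Fin.sum_univ_five, gKY, gKV, trace_fin_two, inv_def, gK_ct, gK_3, adjugate_fin_two, det_fin_two]
    norm_num

def gKE {m : ℕ} (A : Matrix (Fin 2) (Fin 2) ℂ) (B : Matrix (Fin m) (Fin m) ℂ) :
    Matrix (Fin (2 + m)) (Fin (2 + m)) ℂ :=
  (fromBlocks A 0 0 B).submatrix finSumFinEquiv.symm finSumFinEquiv.symm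

theorem gKE_mul {m : ℕ} (A A' : Matrix (Fin 2) (Fin 2) ℂ) (B B' : Matrix (Fin m) (Fin m) ℂ) :
    gKE A B * gKE A' B' = gKE (A * A') (B * B') := by
  rw [gKE, gKE, submatrix_mul_equiv, fromBlocks_multiply, gKE]
  simp

theorem gKE_ct {m : ℕ} (A : Matrix (Fin 2) (Fin 2) ℂ) (B : Matrix (Fin m) (Fin m) ℂ) :
    (gKE A B)ᴴ = gKE Aᴴ Bᴴ := by
  rw [gKE, conjTranspose_submatrix, fromBlocks_conjTranspose, gKE]
  simp

theorem gKE_det {m : ℕ} (A : Matrix (Fin 2) (Fin 2) ℂ) (B : Matrix (Fin m) (Fin m) ℂ) :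
    (gKE A B).det = A.det * B.det := by
  rw [gKE, det_submatrix_equiv_self, det_fromBlocks_zero₂₁]

theorem gKE_trace {m : ℕ} (A : Matrix (Fin 2) (Fin 2) ℂ) (B : Matrix (Fin m) (Fin m) ℂ) :
    (gKE A B).trace = A.trace + B.trace := by
  simp only [trace, diag, gKE, submatrix_apply]
  rw [← finSumFinEquiv.sum_comp]
  simp

theorem gKE_one {m : ℕ} : gKE (1 : Matrix (Fin 2) (Fin 2) ℂ) (1 : Matrix (Fin m) (Fin m) ℂ) = 1 := by
  rw [gKE, fromBlocks_one, submatrix_one_equiv]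

theorem gKE_inv {m : ℕ} (A : Matrix (Fin 2) (Fin 2) ℂ) (hA : A.det ≠ 0) :
    (gKE A (1 : Matrix (Fin m) (Fin m) ℂ))⁻¹ = gKE A⁻¹ 1 := by
  apply Matrix.inv_eq_right_inv
  rw [gKE_mul, mul_nonsing_inv _ hA.isUnit, Matrix.mul_one, gKE_one]

theorem gKE_pd {m : ℕ} (A : Matrix (Fin 2) (Fin 2) ℂ) (hA : A.PosDef) :
    (gKE A (1 : Matrix (Fin m) (Fin m) ℂ)).PosDef := by
  have hd : A.det ≠ 0 := ((Matrix.isUnit_iff_isUnit_det A).1 hA.isUnit).ne_zero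
  have : (gKE A (1 : Matrix (Fin m) (Fin m) ℂ)).PosSemidef := by
    haveI := hA.isUnit.invertible
    refine PosSemidef.submatrix ?_ _
    have := (PosDef.fromBlocks₁₁ (0 : Matrix (Fin 2) (Fin m) ℂ) (1 : Matrix (Fin m) (Fin m) ℂ) hA).2
      (by simpa using PosSemidef.one)
    simpa using this
  rw [this.posDef_iff_det_ne_zero, gKE_det]
  simpa using hd

theorem gKE_uKer {m : ℕ} (A A' : Matrix (Fin 2) (Fin 2) ℂ) :
    uKer (2 + m) (gKE (Complex.I • A) (Complex.I • (1 : Matrix (Fin m) (Fin m) ℂ)))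
      (gKE (Complex.I • A') (Complex.I • (1 : Matrix (Fin m) (Fin m) ℂ))) =
      gKE ((1 / 2 : ℂ) • (A + A'ᴴ)) 1 := by
  rw [uKer, gKE_ct]
  ext i j
  simp only [gKE, Matrix.smul_apply, Matrix.sub_apply, submatrix_apply]
  rcases finSumFinEquiv.symm i with i | i <;> rcases finSumFinEquiv.symm j with j | j
  · simp [conjTranspose_smul]
    linear_combination (-(1/2) * (A i j + (starRingEnd ℂ) (A' j i))) * Complex.I_mul_I
  · simp
  · simp
  · simp [conjTranspose_smul]
    linear_combination (-(1 : Matrix (Fin m) (Fin m) ℂ) i j) * Complex.I_mul_I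

theorem gK_nec (r : ℕ) (hr : 2 ≤ r) (k : ℕ)
    (h : ∀ (N : ℕ) (z : Fin N → Matrix (Fin r) (Fin r) ℂ),
        (∀ i, (uKer r (z i) (z i)).PosDef) →
        ∀ v : Fin N → Matrix (Fin r) (Fin r) ℂ,
        0 ≤ ∑ i, ∑ j,
          ((uKer r (z i) (z j)).det ^ (-(k : ℤ)) •
            ((uKer r (z i) (z j))⁻¹ * v j * (uKer r (z i) (z j))⁻¹ * (v i)ᴴ)).trace) : 2 ≤ k := by
  by_contra hk
  push Not at hk
  obtain ⟨m, rfl⟩ := Nat.exists_eq_add_of_le hr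
  have := h 5 (fun i => gKE (Complex.I • gKY i) (Complex.I • 1))
    (fun i => by rw [gKE_uKer]; exact gKE_pd _ (gK_Ypd i)) (fun i => gKE (gKV (2 ^ k) i) 0)
  have e : ∀ i j : Fin 5, ((gKE ((1 / 2 : ℂ) • (gKY i + (gKY j)ᴴ)) (1 : Matrix (Fin m) (Fin m) ℂ)))⁻¹ =
      gKE ((1 / 2 : ℂ) • (gKY i + (gKY j)ᴴ))⁻¹ 1 := fun i j => gKE_inv _ (gK_Ysum i j _ rfl)
  simp only [gKE_uKer, e, gKE_det, gKE_mul, gKE_ct, trace_smul, gKE_trace] at this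
  have h2 := gK_neg2 k hk
  simp only [trace_smul] at h2
  simp only [det_one, mul_one, conjTranspose_zero, Matrix.mul_zero, trace_zero, add_zero] at this
  rw [h2] at this
  split_ifs at this <;> rw [Complex.le_def] at this <;> norm_num at this

theorem stmt0 (r : ℕ) (hr : 2 ≤ r) (k : ℕ) :
    (∀ z w : Matrix (Fin r) (Fin r) ℂ,
      (uKer r z z).PosDef → (uKer r w w).PosDef → IsUnit (uKer r z w)) ∧
    ((∀ (N : ℕ) (z : Fin N → Matrix (Fin r) (Fin r) ℂ),
        (∀ i, (uKer r (z i) (z i)).PosDef) →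
        ∀ v : Fin N → Matrix (Fin r) (Fin r) ℂ,
        0 ≤ ∑ i, ∑ j,
          ((uKer r (z i) (z j)).det ^ (-(k : ℤ)) •
            ((uKer r (z i) (z j))⁻¹ * v j * (uKer r (z i) (z j))⁻¹ * (v i)ᴴ)).trace) ↔
      2 ≤ k) :=
  ⟨fun _ _ hz hw => (gK_main _ (gK_herm hz hw)).1,
    fun h => gK_nec r hr k h, fun hk N z hz v => gK_suff r N k hk z hz v⟩
end

section
/- Let r ≥ 2 and let D = {z ∈ M_r(ℂ) : zᵀ = z and the imaginary part Im z (an r×r real symmetric matrix) is positive definite} be the Siegel upper half-space. For z, w ∈ D the complex symmetric matrix u(z,w) = (z − conj(w))/(2i) (conj = entrywise complex conjugation) is invertible, and for an integer m ≥ 0 define the kernel K_m(z,w) : Sym_r(ℂ) → Sym_r(ℂ) by K_m(z,w)v = (det u(z,w))^{−m} · u(z,w)⁻¹ v u(z,w)⁻¹. Then K_m is positive definite — i.e. for every N, all z_1,…,z_N ∈ D and all v_1,…,v_N ∈ Sym_r(ℂ), the sum ∑_{i,j=1}^N tr(K_m(z_i,z_j) v_j conj(v_i)) is a nonnegative real number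 — if and only if m ≥ 1. -/
open Matrix
open scoped ComplexOrder

/-- `sKer r z w = (z - conj w)/(2i)`, `conj` being entrywise conjugation. -/
noncomputable def sKer (r : ℕ) (z w : Matrix (Fin r) (Fin r) ℂ) :
    Matrix (Fin r) (Fin r) ℂ :=
  (2 * Complex.I)⁻¹ • (z - w.map (starRingEnd ℂ))

open scoped MatrixOrder in
lemma posSemidef_gram {n : ℕ} {A : Matrix (Fin n) (Fin n) ℝ} (hA : A.PosSemidef) :
    ∃ S : Matrix (Fin n) (Fin n) ℝ, A = Sᴴ * S :=
  CStarAlgebra.nonneg_iff_eq_star_mul_self.mp hA.nonneg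

lemma diag_aux {n : ℕ} (A B : Matrix (Fin n) (Fin n) ℝ) (hA : A.PosDef) (hB : B.IsSymm) :
    ∃ (T : Matrix (Fin n) (Fin n) ℝ) (d : Fin n → ℝ), IsUnit T ∧ A = Tᵀ * T ∧
      B = Tᵀ * diagonal d * T := by
  obtain ⟨S, hSu, hS⟩ : ∃ S : Matrix (Fin n) (Fin n) ℝ, IsUnit S ∧ A = Sᵀ * S := by
    obtain ⟨S, hS⟩ := posSemidef_gram hA.posSemidef
    refine ⟨S, ?_, by simpa using hS⟩
    have h := hA.isUnit
    rw [hS] at h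
    exact isUnit_of_mul_isUnit_right h
  have hSd := (Matrix.isUnit_iff_isUnit_det S).mp hSu
  have hB' : (S⁻¹ᵀ * B * S⁻¹).IsHermitian := by
    rw [Matrix.IsHermitian, conjTranspose_eq_transpose_of_trivial]
    simp [Matrix.transpose_mul, hB.eq, Matrix.mul_assoc]
  have hsp := hB'.spectral_theorem
  set U : Matrix (Fin n) (Fin n) ℝ := (hB'.eigenvectorUnitary : Matrix (Fin n) (Fin n) ℝ) with hU
  have hUU : U * Uᵀ = 1 := by
    have := (Matrix.mem_unitaryGroup_iff).mp hB'.eigenvectorUnitary.2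
    simpa [star_eq_conjTranspose] using this
  refine ⟨Uᵀ * S, hB'.eigenvalues, ?_, ?_, ?_⟩
  · refine IsUnit.mul ?_ hSu
    exact IsUnit.of_mul_eq_one _ (mul_eq_one_comm.mp hUU)
  · rw [Matrix.transpose_mul, Matrix.transpose_transpose]
    calc A = Sᵀ * (U * Uᵀ) * S := by rw [hUU, Matrix.mul_one, hS]
      _ = _ := by simp only [Matrix.mul_assoc]
  · have h1 : S⁻¹ᵀ * B * S⁻¹ = U * diagonal hB'.eigenvalues * Uᵀ := by
      rw [Unitary.conjStarAlgAut_apply] at hsp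
      simpa [star_eq_conjTranspose, ← hU, Function.comp_def] using hsp
    have h2 : B = Sᵀ * (S⁻¹ᵀ * B * S⁻¹) * S := by
      have : Sᵀ * S⁻¹ᵀ = 1 := by
        rw [← Matrix.transpose_mul, Matrix.nonsing_inv_mul _ hSd, Matrix.transpose_one]
      calc B = (Sᵀ * S⁻¹ᵀ) * B * (S⁻¹ * S) := by
            rw [this, Matrix.nonsing_inv_mul _ hSd, Matrix.one_mul, Matrix.mul_one]
        _ = _ := by simp only [Matrix.mul_assoc]
    refine h2.trans ((congrArg (fun X => Sᵀ * X * S) h1).trans ?_)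
    rw [Matrix.transpose_mul, Matrix.transpose_transpose]
    simp only [Matrix.mul_assoc]

/-- structure of `u` -/
lemma sKer_diag {r : ℕ} (z w : Matrix (Fin r) (Fin r) ℂ)
    (hz : z.IsSymm) (hzi : (z.map Complex.im).PosDef)
    (hw : w.IsSymm) (hwi : (w.map Complex.im).PosDef) :
    ∃ (T : Matrix (Fin r) (Fin r) ℝ) (l : Fin r → ℂ), IsUnit T ∧ (∀ k, 0 < (l k).re) ∧
      sKer r z w = (T.map Complex.ofReal)ᵀ * diagonal l * T.map Complex.ofReal := by
  obtain ⟨T, d, hT, hA, hB⟩ := diag_aux ((1/2 : ℝ) • (z.map Complex.im + w.map Complex.im))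
    ((1/2 : ℝ) • (w.map Complex.re - z.map Complex.re)) ((hzi.add hwi).smul (by norm_num))
    (by
      ext i j
      simp [hz.apply i j, hw.apply i j])
  refine ⟨T, fun k => 1 + Complex.I * d k, hT, fun k => by simp, ?_⟩
  have h1 : sKer r z w = ((1/2 : ℝ) • (z.map Complex.im + w.map Complex.im)).map Complex.ofReal
      + Complex.I • ((1/2 : ℝ) • (w.map Complex.re - z.map Complex.re)).map Complex.ofReal := by
    ext i j
    apply Complex.ext <;> simp [sKer] <;> ring
  rw [h1, hA, hB]
  have h2 : (diagonal fun k => 1 + Complex.I * (d k : ℂ)) =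
      1 + Complex.I • (diagonal d).map Complex.ofReal := by
    ext i j
    by_cases h : i = j
    · subst h; simp
    · simp [h]
  have hm : ∀ M N : Matrix (Fin r) (Fin r) ℝ, (M * N).map Complex.ofReal =
    M.map Complex.ofReal * N.map Complex.ofReal := fun M N => Matrix.map_mul (f := Complex.ofRealHom)
  rw [h2, hm, hm, hm, Matrix.transpose_map]
  simp [Matrix.mul_add, Matrix.add_mul]

lemma sKer_isUnit {r : ℕ} (z w : Matrix (Fin r) (Fin r) ℂ)
    (hz : z.IsSymm) (hzi : (z.map Complex.im).PosDef)
    (hw : w.IsSymm) (hwi : (w.map Complex.im).PosDef) : IsUnit (sKer r z w) := by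
  obtain ⟨T, l, hT, hl, h⟩ := sKer_diag z w hz hzi hw hwi
  have hT' : IsUnit (T.map Complex.ofReal) := by
    exact hT.map (Complex.ofRealHom.mapMatrix)
  rw [h]
  refine IsUnit.mul (IsUnit.mul ((Matrix.isUnit_transpose _).mpr hT') ?_) hT'
  rw [Matrix.isUnit_diagonal, Pi.isUnit_iff]
  intro k
  rw [isUnit_iff_ne_zero]
  intro h0
  have := hl k
  simp [h0] at this

noncomputable def qM (k : ℕ) (p q : ℝ) : Fin (k+2) → ℝ := Pi.single 0 p + Pi.single 1 q

noncomputable def zM (k : ℕ) (p q : ℝ) : Matrix (Fin (k+2)) (Fin (k+2)) ℂ :=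
  Complex.I • (1 + Matrix.vecMulVec (qM k p q) (qM k p q)).map Complex.ofReal

lemma zM_im (k : ℕ) (p q : ℝ) : ((zM k p q).map Complex.im).PosDef := by
  have : (zM k p q).map Complex.im = 1 + Matrix.vecMulVec (qM k p q) (star (qM k p q)) := by
    ext i j; simp [zM]
  rw [this]
  exact Matrix.PosDef.one.add_posSemidef (posSemidef_vecMulVec_self_star _)

lemma zM_symm (k : ℕ) (p q : ℝ) : (zM k p q).IsSymm := by
  ext i j
  by_cases h : i = j
  · subst h; simp
  · simp [zM, h, Ne.symm h, Matrix.vecMulVec_apply, mul_comm]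

lemma inv00 (k : ℕ) (p q p' q' : ℝ) 
    (D : ℝ) (hD : (2 + p^2+p'^2)*(2+q^2+q'^2)-(p*q+p'*q')^2 = D) (h0 : D ≠ 0) :
    (sKer (k+2) (zM k p q) (zM k p' q'))⁻¹ 0 0 = ((2 * (2+q^2+q'^2) / D : ℝ) : ℂ) := by
  have hu := (Matrix.isUnit_iff_isUnit_det _).mp
    (sKer_isUnit _ _ (zM_symm k p q) (zM_im k p q) (zM_symm k p' q') (zM_im k p' q'))
  set u := sKer (k+2) (zM k p q) (zM k p' q') with hudef
  let x : Fin (k+2) → ℂ := Pi.single 0 ((2 * (2+q^2+q'^2) / D : ℝ) : ℂ) +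
    Pi.single 1 ((-2 * (p*q+p'*q') / D : ℝ) : ℂ)
  have hux : u = (1 + (1/2 : ℝ) • Matrix.vecMulVec (qM k p q) (qM k p q) +
     (1/2 : ℝ) • Matrix.vecMulVec (qM k p' q') (qM k p' q')).map Complex.ofReal := by
    ext i j
    by_cases h : i = j
    · subst h; apply Complex.ext <;> simp [hudef, sKer, zM] <;> ring
    · apply Complex.ext <;> simp [hudef, sKer, zM, h] <;> ring
  have hx : u *ᵥ x = Pi.single 0 1 := by
    have hDC : (D : ℂ) ≠ 0 := by exact_mod_cast h0
    have hD' : (D:ℂ) = (2 + p^2+p'^2)*(2+q^2+q'^2)-(p*q+p'*q')^2 := by rw [← hD]; push_cast; ring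
    rw [Matrix.mulVec_add, Matrix.mulVec_single, Matrix.mulVec_single, hux]
    ext i
    refine Fin.cases ?_ (fun i => ?_) i
    · simp [qM, Matrix.vecMulVec_apply, Matrix.one_apply]
      field_simp
      rw [hD']; ring
    · refine Fin.cases ?_ (fun i => ?_) i
      · simp [qM, Matrix.vecMulVec_apply, Matrix.one_apply]
        field_simp
        ring
      · have h1 : (i.succ.succ : Fin (k+2)) ≠ 0 := Fin.succ_ne_zero _
        have h2 : (i.succ.succ : Fin (k+2)) ≠ 1 := by
          intro h; exact Fin.succ_ne_zero i (Fin.succ_injective _ h)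
        simp [qM, Matrix.vecMulVec_apply, Matrix.one_apply, h1, h2]
  have : u⁻¹ *ᵥ (u *ᵥ x) = x := by
    rw [Matrix.mulVec_mulVec, Matrix.nonsing_inv_mul _ hu, Matrix.one_mulVec]
  rw [hx] at this
  have h3 := congrFun this 0
  simpa [x] using h3

lemma tr00 {n : ℕ} (U : Matrix (Fin (n+1)) (Fin (n+1)) ℂ) (s t : ℝ) :
    (U * Matrix.single 0 0 (s:ℂ) * U * (Matrix.single 0 0 (t:ℂ)).map (starRingEnd ℂ)).trace
      = s * t * (U 0 0)^2 := by
  have : (Matrix.single 0 0 (t:ℂ) : Matrix (Fin (n+1)) (Fin (n+1)) ℂ).map (starRingEnd ℂ)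
     = Matrix.single 0 0 (t:ℂ) := by
    ext i j; simp [Matrix.single_apply]; split_ifs <;> simp
  rw [this, Matrix.trace_mul_single]
  simp [Matrix.mul_apply, Matrix.single_apply, ite_and]
  ring

lemma counter (k : ℕ) : ¬ (∀ (N : ℕ) (z : Fin N → Matrix (Fin (k+2)) (Fin (k+2)) ℂ),
        (∀ i, (z i).IsSymm) → (∀ i, ((z i).map Complex.im).PosDef) →
        ∀ v : Fin N → Matrix (Fin (k+2)) (Fin (k+2)) ℂ, (∀ i, (v i).IsSymm) →
        0 ≤ ∑ i, ∑ j,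
          ((sKer (k+2) (z i) (z j)).det ^ (-((0:ℕ) : ℤ)) •
            ((sKer (k+2) (z i) (z j))⁻¹ * v j * (sKer (k+2) (z i) (z j))⁻¹ *
              (v i).map (starRingEnd ℂ))).trace) := by
  intro H
  let p : Fin 3 → ℝ := ![1, 0, 1]
  let q : Fin 3 → ℝ := ![4, 0, -4]
  let s : Fin 3 → ℝ := ![1, -2, 1]
  have h := H 3 (fun i => zM k (p i) (q i)) (fun i => zM_symm _ _ _) (fun i => zM_im _ _ _)
    (fun i => Matrix.single 0 0 (s i : ℂ)) (fun i => by
      simp [Matrix.IsSymm])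
  simp only [Nat.cast_zero, neg_zero, zpow_zero, one_smul, tr00] at h
  have h2 : ∀ i j, (sKer (k+2) (zM k (p i) (q i)) (zM k (p j) (q j)))⁻¹ 0 0 = 
     ((2 * (2+q i^2+q j^2) / ((2 + p i^2+p j^2)*(2+q i^2+q j^2)-(p i*q i+p j*q j)^2) : ℝ) : ℂ) := by
    intro i j
    refine inv00 k _ _ _ _ _ rfl ?_
    fin_cases i <;> fin_cases j <;> norm_num [p, q]
  simp only [h2] at h
  have h3 : (0:ℝ) ≤ ∑ i, ∑ j, s j * s i * 
    (2 * (2+q i^2+q j^2) / ((2 + p i^2+p j^2)*(2+q i^2+q j^2)-(p i*q i+p j*q j)^2))^2 := by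
    exact_mod_cast h
  simp only [Fin.sum_univ_three] at h3
  have e1 : p 0 = 1 := rfl
  have e2 : p 1 = 0 := rfl
  have e3 : p 2 = 1 := rfl
  have e4 : q 0 = 4 := rfl
  have e5 : q 1 = 0 := rfl
  have e6 : q 2 = -4 := rfl
  have e7 : s 0 = 1 := rfl
  have e8 : s 1 = -2 := rfl
  have e9 : s 2 = 1 := rfl
  rw [e1, e2, e3, e4, e5, e6, e7, e8, e9] at h3
  norm_num at h3

open MeasureTheory in
lemma radial (l A B C : ℂ) (hl : 0 < l.re) :
    ∫ t : ℝ in Set.Ioi 0, ((2*l*A*t^5 + (2*l*B-4*A)*t^3 + (2*l*C-2*B)*t) *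
      Complex.exp (-l * (t:ℂ)^2)) = C := by
  have hint : ∀ n : ℕ, Integrable fun x : ℝ => (x:ℂ)^n * Complex.exp (-l * (x:ℂ)^2) := by
    intro n
    refine (integrable_norm_iff (by fun_prop)).mp ?_
    have h := (integrable_rpow_mul_exp_neg_mul_sq hl (s := n) (by
      have : (0:ℝ) ≤ n := n.cast_nonneg
      linarith)).norm
    refine h.congr (Filter.Eventually.of_forall fun x => ?_)
    simp only [norm_mul, norm_cexp_neg_mul_sq, norm_pow, Complex.norm_real, Real.rpow_natCast,
      Real.norm_eq_abs, Real.abs_exp]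
  have hd : ∀ x : ℂ, HasDerivAt (fun x => -((A*x^4+B*x^2+C) * Complex.exp (-l * x ^ 2)))
      ((2*l*A*x^5 + (2*l*B-4*A)*x^3 + (2*l*C-2*B)*x) * Complex.exp (-l * x^2)) x := by
    intro x
    have h1 := ((hasDerivAt_pow 2 x).const_mul (-l)).cexp
    have h2 := ((((hasDerivAt_pow 4 x).const_mul A).add
      ((hasDerivAt_pow 2 x).const_mul B)).add_const C)
    convert! (h2.mul h1).neg using 1
    simp
    ring
  have ht : Filter.Tendsto (fun y : ℝ ↦ -((A*y^4+B*y^2+C) * Complex.exp (-l * (y : ℂ) ^ 2)))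
      Filter.atTop (nhds (-(A * 0 + B * 0 + C * 0))) := by
    have h0 : ∀ n : ℕ, Filter.Tendsto (fun y : ℝ => (y:ℂ)^n * Complex.exp (-l * (y:ℂ)^2))
        Filter.atTop (nhds 0) := by
      intro n
      rw [tendsto_zero_iff_norm_tendsto_zero]
      have h := (rpow_mul_exp_neg_mul_sq_isLittleO_exp_neg hl (n:ℝ)).trans_tendsto
        (g'' := fun x : ℝ => Real.exp (-(1/2) * x)) (by
          exact Real.tendsto_exp_atBot.comp (Filter.tendsto_id.const_mul_atTop_of_neg (by norm_num)))
      refine h.norm.congr' ?_ |>.trans (by simp)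
      filter_upwards with x
      simp only [norm_mul, norm_cexp_neg_mul_sq, norm_pow, Complex.norm_real, Real.rpow_natCast,
        Real.norm_eq_abs, Real.abs_exp]
    have := (((h0 4).const_mul A).add ((h0 2).const_mul B)).add ((h0 0).const_mul C)
    refine this.neg.congr fun y => ?_
    ring
  have := integral_Ioi_of_hasDerivAt_of_tendsto' (a := 0) (fun x _ => (hd ↑x).comp_ofReal)
      (Integrable.integrableOn ?_) ht
  · rw [this]; simp
  · have := (((hint 5).const_mul (2*l*A)).add ((hint 3).const_mul (2*l*B-4*A))).add
      ((hint 1).const_mul (2*l*C-2*B))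
    refine this.congr (Filter.Eventually.of_forall fun x => ?_)
    simp
    ring

open MeasureTheory in
lemma polar (f : ℝ → ℂ) : ∫ x : ℂ, f ‖x‖ = 2 * Real.pi * ∫ t : ℝ in Set.Ioi 0, t * f t := by
  rw [← Complex.integral_comp_polarCoord_symm, polarCoord_target]
  simp_rw [Complex.norm_polarCoord_symm]
  have h1 : (∫ x in Set.Ioi (0 : ℝ) ×ˢ Set.Ioo (-Real.pi) Real.pi, x.1 • f |x.1|) =
    (∫ x in Set.Ioi (0 : ℝ), x * f |x|) * ∫ _ in Set.Ioo (-Real.pi) Real.pi, (1:ℂ) := by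
      rw [← setIntegral_prod_mul, Measure.volume_eq_prod]
      simp
  rw [h1]
  have h2 : (∫ x in Set.Ioi (0 : ℝ), x * f |x|) = ∫ x in Set.Ioi (0 : ℝ), x * f x := by
    refine setIntegral_congr_fun measurableSet_Ioi (fun x hx => ?_)
    rw [Set.mem_Ioi] at hx
    simp [abs_eq_self.mpr hx.le]
  rw [h2, mul_comm]
  congr 1
  simp only [integral_const, MeasurableSet.univ, measureReal_restrict_apply,
        Set.univ_inter, Complex.real_smul, mul_one]
  rw [Real.volume_real_Ioo_of_le (by linarith [Real.pi_nonneg])]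
  push_cast; ring

/-- one-dimensional moment integrand -/
noncomputable def mom (l : ℂ) (p q : ℕ) (x : ℂ) : ℂ :=
  Complex.exp (-l * (‖x‖:ℂ)^2) * (x^p * (starRingEnd ℂ x)^q)

open MeasureTheory in
lemma mom_integrable (l : ℂ) (hl : 0 < l.re) (p q : ℕ) : Integrable (mom l p q) := by
  have h1 : Integrable (fun x : ℂ => ‖x‖ ^ ((p+q : ℕ):ℝ) * Real.exp (-l.re * ‖x‖^(2:ℝ))) := by
    apply Integrable.of_integral_ne_zero
    have h0 : (0:ℝ) ≤ ((p+q : ℕ):ℝ) := Nat.cast_nonneg _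
    rw [Complex.integral_rpow_mul_exp_neg_mul_rpow (by norm_num) (by linarith) hl]
    have := Real.Gamma_pos_of_pos (show 0 < (((p+q : ℕ):ℝ)+2)/2 by positivity)
    positivity
  refine (integrable_norm_iff (by unfold mom; fun_prop)).mp ?_
  refine h1.congr (Filter.Eventually.of_forall fun x => ?_)
  simp only [mom, norm_mul, norm_cexp_neg_mul_sq, norm_pow, Real.rpow_natCast, RCLike.norm_conj, Real.rpow_two]
  ring

open MeasureTheory in
lemma mom_integral (l : ℂ) (hl : 0 < l.re) (p q : ℕ) (hp : p ≤ 2) (hq : q ≤ 2) :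
    ∫ x, mom l p q x = if p = q then (Real.pi / l) * (p.factorial / l^p) else 0 := by
  have hl0 : l ≠ 0 := by rintro rfl; simp at hl
  split_ifs with h
  · subst h
    have h1 : ∀ x : ℂ, mom l p p x = (fun t : ℝ => Complex.exp (-l * (t:ℂ)^2) * (t:ℂ)^(2*p)) ‖x‖ := by
      intro x
      simp only [mom]
      rw [← mul_pow, Complex.mul_conj, Complex.normSq_eq_norm_sq, pow_mul]
      push_cast; ring
    simp_rw [h1]
    rw [polar (fun t : ℝ => Complex.exp (-l * (t:ℂ)^2) * (t:ℂ)^(2*p))]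
    interval_cases p
    · have := radial l 0 0 (1/(2*l)) hl
      rw [show (∫ t : ℝ in Set.Ioi 0, (t:ℂ) * (Complex.exp (-l * (t:ℂ)^2) * (t:ℂ)^(2*0))) = 1/(2*l) by
        rw [← this]; congr 1; ext t; field_simp; ring]
      simp; field_simp
    · have := radial l 0 (1/(2*l)) (1/(2*l^2)) hl
      rw [show (∫ t : ℝ in Set.Ioi 0, (t:ℂ) * (Complex.exp (-l * (t:ℂ)^2) * (t:ℂ)^(2*1))) = 1/(2*l^2) by
        rw [← this]; congr 1; ext t; field_simp; ring]
      simp; field_simp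
    · have := radial l (1/(2*l)) (1/l^2) (1/l^3) hl
      rw [show (∫ t : ℝ in Set.Ioi 0, (t:ℂ) * (Complex.exp (-l * (t:ℂ)^2) * (t:ℂ)^(2*2))) = 1/l^3 by
        rw [← this]; congr 1; ext t; field_simp; ring]
      simp; field_simp
  · have hmp := (rotation ⟨Complex.I, by simp [Submonoid.unitSphere]⟩).measurePreserving
    have h1 := hmp.integral_comp (rotation ⟨Complex.I, by simp [Submonoid.unitSphere]⟩).toHomeomorph.measurableEmbedding
      (mom l p q)
    have h2 : ∀ x, mom l p q (Complex.I * x) = (Complex.I^p * (-Complex.I)^q) * mom l p q x := by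
      intro x
      simp [mom, mul_pow]
      ring
    replace h1 : ∫ x, mom l p q (Complex.I * x) = ∫ x, mom l p q x := h1
    simp_rw [h2] at h1
    rw [integral_const_mul] at h1
    have h3 : (Complex.I^p * (-Complex.I)^q) ≠ 1 := by
      interval_cases p <;> interval_cases q <;> (first | (exfalso; exact h rfl) | norm_num [Complex.ext_iff])
    have h4 : (Complex.I^p * (-Complex.I)^q - 1) * ∫ x, mom l p q x = 0 := by
      rw [sub_mul, h1, one_mul, sub_self]
    exact (mul_eq_zero.mp h4).resolve_left (sub_ne_zero.mpr h3)

open MeasureTheory in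
lemma cov {r : ℕ} (T : Matrix (Fin r) (Fin r) ℝ) (hT : IsUnit T) (F : (Fin r → ℂ) → ℂ)
    (hF : Integrable F) :
    Integrable (fun x => F (T.map Complex.ofReal *ᵥ x)) ∧
    ∫ x, F (T.map Complex.ofReal *ᵥ x) = ((T.map Complex.ofReal).det^2)⁻¹ * ∫ x, F x := by
  have hTd : T.det ≠ 0 := ((Matrix.isUnit_iff_isUnit_det T).mp hT).ne_zero
  have hdet : (T.map Complex.ofReal).det = (T.det : ℂ) := by
    exact (RingHom.map_det Complex.ofRealHom T).symm
  set L : (Fin r → ℂ) →ₗ[ℝ] (Fin r → ℂ) := (Matrix.toLin' (T.map Complex.ofReal)).restrictScalars ℝ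
  have hL : LinearMap.det L = T.det^2 := by
    rw [LinearMap.det_restrictScalars, LinearMap.det_toLin', hdet, Algebra.norm_complex_eq]
    simp [Complex.normSq_ofReal, sq]
  have hmap := Measure.map_linearMap_addHaar_eq_smul_addHaar (volume : Measure (Fin r → ℂ))
    (f := L) (by rw [hL]; positivity)
  have hLm : Measurable L := (LinearMap.continuous_of_finiteDimensional L).measurable
  have hF2 : Integrable F (Measure.map L volume) := by
    rw [hmap]; exact hF.smul_measure ENNReal.ofReal_ne_top
  constructor
  · exact hF2.comp_measurable hLm
  · have := integral_map hLm.aemeasurable hF2.aestronglyMeasurable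
    rw [hmap, integral_smul_measure] at this
    rw [hdet]
    refine this.symm.trans ?_
    rw [hL, ENNReal.toReal_ofReal (abs_nonneg _), abs_of_nonneg (by positivity)]
    simp

lemma idx {r : ℕ} (a b c d : Fin r) :
    (∀ k, ((if k = a then 1 else 0) + (if k = b then 1 else 0) : ℕ) =
      (if k = c then 1 else 0) + (if k = d then 1 else 0)) ↔ (a = c ∧ b = d) ∨ (a = d ∧ b = c) := by
  constructor
  · intro h
    have ha := h a
    have hb := h b
    have hc := h c
    have hd := h d
    by_cases h1 : a = b <;> by_cases h2 : a = c <;> by_cases h3 : a = d <;>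
      by_cases h4 : b = c <;> by_cases h5 : b = d <;> simp_all
  · rintro (⟨rfl, rfl⟩ | ⟨rfl, rfl⟩) k
    · rfl
    · exact add_comm _ _

/-- exponents -/
def ex {r : ℕ} (a b k : Fin r) : ℕ := (if k = a then 1 else 0) + (if k = b then 1 else 0)

lemma ex_le {r : ℕ} (a b k : Fin r) : ex a b k ≤ 2 := by
  unfold ex; split_ifs <;> simp

lemma prod_ex {r : ℕ} (a b : Fin r) (x : Fin r → ℂ) : ∏ k, x k ^ ex a b k = x a * x b := by
  simp only [ex, pow_add, Finset.prod_mul_distrib, pow_ite, pow_one, pow_zero,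
    Finset.prod_ite_eq', Finset.mem_univ, if_true]

lemma prod_fact {r : ℕ} (a b : Fin r) :
    ∏ k, ((ex a b k).factorial : ℂ) = if a = b then 2 else 1 := by
  split_ifs with h
  · subst h
    rw [Finset.prod_eq_single a]
    · simp [ex]
    · intro k _ hk; simp [ex, hk]
    · simp
  · apply Finset.prod_eq_one
    intro k _
    by_cases h1 : k = a
    · subst h1; simp [ex, h]
    · by_cases h2 : k = b <;> simp [ex, h1, h2, Ne.symm h]

open MeasureTheory in
lemma moment4 {r : ℕ} (l : Fin r → ℂ) (hl : ∀ k, 0 < (l k).re) (a b c d : Fin r) :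
    Integrable (fun x : Fin r → ℂ => Complex.exp (-∑ k, l k * (‖x k‖:ℂ)^2) *
      (x a * x b * (starRingEnd ℂ (x c) * starRingEnd ℂ (x d)))) ∧
    ∫ x : Fin r → ℂ, Complex.exp (-∑ k, l k * (‖x k‖:ℂ)^2) *
      (x a * x b * (starRingEnd ℂ (x c) * starRingEnd ℂ (x d))) =
      (Real.pi^r / ∏ k, l k) * (((if a = c ∧ b = d then 1 else 0) +
        (if a = d ∧ b = c then 1 else 0)) / (l a * l b)) := by
  have hfun : (fun x : Fin r → ℂ => Complex.exp (-∑ k, l k * (‖x k‖:ℂ)^2) *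
      (x a * x b * (starRingEnd ℂ (x c) * starRingEnd ℂ (x d)))) =
      fun x => ∏ k, mom (l k) (ex a b k) (ex c d k) (x k) := by
    ext x
    simp only [mom, Finset.prod_mul_distrib]
    rw [prod_ex, prod_ex c d (fun k => starRingEnd ℂ (x k)), ← Complex.exp_sum]
    simp
  rw [hfun]
  constructor
  · exact Integrable.fintype_prod (fun k => mom_integrable (l k) (hl k) _ _)
  · rw [integral_fintype_prod_volume_eq_prod]
    rw [Finset.prod_congr rfl (fun k _ => mom_integral (l k) (hl k) _ _ (ex_le a b k) (ex_le c d k))]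
    by_cases h : ∀ k, ex a b k = ex c d k
    · have h' := (idx a b c d).mp h
      simp only [h, if_true]
      simp only [← h, Finset.prod_mul_distrib, Finset.prod_div_distrib, prod_ex, prod_fact,
        Finset.prod_const, Finset.card_univ, Fintype.card_fin]
      congr 2
      rcases h' with ⟨rfl, rfl⟩ | ⟨rfl, rfl⟩
      · by_cases hab : a = b
        · subst hab; norm_num
        · simp [hab]
      · by_cases hab : a = b
        · subst hab; norm_num
        · simp [hab]
    · have h' := mt (idx a b c d).mpr h
      push Not at h
      obtain ⟨k, hk⟩ := h
      rw [Finset.prod_eq_zero (Finset.mem_univ k) (by rw [if_neg hk])]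
      rw [not_or] at h'
      simp [h'.1, h'.2]

open MeasureTheory in
lemma moment0 {r : ℕ} (l : Fin r → ℂ) (hl : ∀ k, 0 < (l k).re) :
    Integrable (fun x : Fin r → ℂ => Complex.exp (-∑ k, l k * (‖x k‖:ℂ)^2)) ∧
    ∫ x : Fin r → ℂ, Complex.exp (-∑ k, l k * (‖x k‖:ℂ)^2) = (Real.pi^r / ∏ k, l k) := by
  have hfun : (fun x : Fin r → ℂ => Complex.exp (-∑ k, l k * (‖x k‖:ℂ)^2)) =
      fun x => ∏ k, mom (l k) 0 0 (x k) := by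
    ext x
    simp only [mom, Finset.prod_mul_distrib]
    rw [← Complex.exp_sum]
    simp
  rw [hfun]
  constructor
  · exact Integrable.fintype_prod (fun k => mom_integrable (l k) (hl k) _ _)
  · rw [integral_fintype_prod_volume_eq_prod]
    rw [Finset.prod_congr rfl (fun k _ => mom_integral (l k) (hl k) 0 0 (by simp) (by simp))]
    simp [Finset.prod_div_distrib]

lemma star_quad {r : ℕ} (l : Fin r → ℂ) (x : Fin r → ℂ) :
    star x ⬝ᵥ (diagonal l *ᵥ x) = ∑ k, l k * (‖x k‖:ℂ)^2 := by
  simp only [dotProduct, mulVec_diagonal, Pi.star_apply]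
  refine Finset.sum_congr rfl fun k _ => ?_
  have := Complex.mul_conj (x k)
  rw [Complex.normSq_eq_norm_sq] at this
  push_cast at this
  rw [← this]
  simp; ring

open MeasureTheory in
lemma diag4 {r : ℕ} (l : Fin r → ℂ) (hl : ∀ k, 0 < (l k).re) (v w : Matrix (Fin r) (Fin r) ℂ)
    (hv : v.IsSymm) :
    Integrable (fun x : Fin r → ℂ => Complex.exp (-(star x ⬝ᵥ (diagonal l *ᵥ x))) *
      ((x ⬝ᵥ (w *ᵥ x)) * (star x ⬝ᵥ (v *ᵥ star x)))) ∧
    ∫ x : Fin r → ℂ, Complex.exp (-(star x ⬝ᵥ (diagonal l *ᵥ x))) *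
      ((x ⬝ᵥ (w *ᵥ x)) * (star x ⬝ᵥ (v *ᵥ star x))) =
      (Real.pi^r / ∏ k, l k) * (2 * ∑ a, ∑ b, w a b * v a b / (l a * l b)) := by
  have hfun : (fun x : Fin r → ℂ => Complex.exp (-(star x ⬝ᵥ (diagonal l *ᵥ x))) *
      ((x ⬝ᵥ (w *ᵥ x)) * (star x ⬝ᵥ (v *ᵥ star x)))) =
      fun x => ∑ a, ∑ b, ∑ c, ∑ d, (w a b * v c d) * (Complex.exp (-∑ k, l k * (‖x k‖:ℂ)^2) *
      (x a * x b * (starRingEnd ℂ (x c) * starRingEnd ℂ (x d)))) := by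
    ext x
    rw [star_quad, mul_comm (x ⬝ᵥ (w *ᵥ x))]
    simp only [dotProduct, mulVec, Finset.mul_sum, Finset.sum_mul, Pi.star_apply]
    refine Finset.sum_congr rfl fun a _ => ?_
    refine Finset.sum_congr rfl fun b _ => ?_
    refine Finset.sum_congr rfl fun c _ => ?_
    refine Finset.sum_congr rfl fun d _ => ?_
    simp only [RCLike.star_def]
    ring
  have hi : ∀ a b c d, Integrable (fun x : Fin r → ℂ =>
     (w a b * v c d) * (Complex.exp (-∑ k, l k * (‖x k‖:ℂ)^2) *
      (x a * x b * (starRingEnd ℂ (x c) * starRingEnd ℂ (x d))))) :=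
    fun a b c d => (moment4 l hl a b c d).1.const_mul _
  rw [hfun]
  constructor
  · exact integrable_finsetSum _ fun a _ => integrable_finsetSum _ fun b _ =>
      integrable_finsetSum _ fun c _ => integrable_finsetSum _ fun d _ => hi a b c d
  · rw [integral_finsetSum _ fun a _ => integrable_finsetSum _ fun b _ =>
      integrable_finsetSum _ fun c _ => integrable_finsetSum _ fun d _ => hi a b c d,
      Finset.mul_sum, Finset.mul_sum]
    refine Finset.sum_congr rfl fun a _ => ?_
    rw [integral_finsetSum _ fun b _ =>
      integrable_finsetSum _ fun c _ => integrable_finsetSum _ fun d _ => hi a b c d,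
      Finset.mul_sum, Finset.mul_sum]
    refine Finset.sum_congr rfl fun b _ => ?_
    rw [integral_finsetSum _ fun c _ => integrable_finsetSum _ fun d _ => hi a b c d]
    simp_rw [integral_finsetSum _ fun d _ => hi a b _ d, integral_const_mul,
      (moment4 l hl a b _ _).2]
    have e1 : ∀ c d, (w a b * v c d) * ((Real.pi^r / ∏ k, l k) *
        (((if a = c ∧ b = d then 1 else 0) + (if a = d ∧ b = c then 1 else 0)) / (l a * l b))) =
        (if a = c then (if b = d then (w a b * v c d) * ((Real.pi^r / ∏ k, l k) * (1 / (l a * l b))) else 0) else 0) +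
        (if a = d then (if b = c then (w a b * v c d) * ((Real.pi^r / ∏ k, l k) * (1 / (l a * l b))) else 0) else 0) := by
      intro c d
      rw [← ite_and, ← ite_and]
      split_ifs <;> ring
    simp_rw [e1, Finset.sum_add_distrib]
    simp
    rw [hv.apply a b]
    ring

lemma star_map_mulVec {r : ℕ} (T : Matrix (Fin r) (Fin r) ℝ) (x : Fin r → ℂ) :
    star (T.map Complex.ofReal *ᵥ x) = T.map Complex.ofReal *ᵥ star x := by
  ext i
  simp [mulVec, dotProduct]

lemma quad_conj {r : ℕ} (S M : Matrix (Fin r) (Fin r) ℂ) (x y : Fin r → ℂ) :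
    y ⬝ᵥ ((Sᵀ * M * S) *ᵥ x) = (S *ᵥ y) ⬝ᵥ (M *ᵥ (S *ᵥ x)) := by
  rw [← Matrix.mulVec_mulVec, ← Matrix.mulVec_mulVec, Matrix.dotProduct_mulVec,
    Matrix.vecMul_transpose]

lemma tr_diag {r : ℕ} (l : Fin r → ℂ) (v w : Matrix (Fin r) (Fin r) ℂ) (hw : w.IsSymm) :
    (diagonal (fun k => (l k)⁻¹) * v * diagonal (fun k => (l k)⁻¹) * w).trace =
      ∑ a, ∑ b, w a b * v a b / (l a * l b) := by
  simp only [Matrix.trace, Matrix.diag_apply, Matrix.mul_apply (N := w), Matrix.mul_diagonal,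
    Matrix.diagonal_mul]
  refine Finset.sum_congr rfl fun a _ => Finset.sum_congr rfl fun b _ => ?_
  rw [hw.apply a b, div_eq_mul_inv, mul_inv]
  ring

open MeasureTheory in
lemma gen4 {r : ℕ} (z w : Matrix (Fin r) (Fin r) ℂ)
    (hz : z.IsSymm) (hzi : (z.map Complex.im).PosDef)
    (hw : w.IsSymm) (hwi : (w.map Complex.im).PosDef) (a b : Matrix (Fin r) (Fin r) ℂ)
    (ha : a.IsSymm) (hb : b.IsSymm) :
    Integrable (fun x : Fin r → ℂ => Complex.exp (-(star x ⬝ᵥ (sKer r z w *ᵥ x))) *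
      ((x ⬝ᵥ (a *ᵥ x)) * (star x ⬝ᵥ (b *ᵥ star x)))) ∧
    ∫ x : Fin r → ℂ, Complex.exp (-(star x ⬝ᵥ (sKer r z w *ᵥ x))) *
      ((x ⬝ᵥ (a *ᵥ x)) * (star x ⬝ᵥ (b *ᵥ star x))) =
      (2 * Real.pi^r : ℝ) * ((sKer r z w).det⁻¹ *
        ((sKer r z w)⁻¹ * b * (sKer r z w)⁻¹ * a).trace) := by
  obtain ⟨T, l, hT, hl, hu⟩ := sKer_diag z w hz hzi hw hwi
  have hl0 : ∀ k, l k ≠ 0 := fun k h => by have := hl k; simp [h] at this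
  set S := T.map Complex.ofReal with hS
  have hSu : IsUnit S := hT.map (Complex.ofRealHom.mapMatrix)
  have hSd : IsUnit S.det := (Matrix.isUnit_iff_isUnit_det S).mp hSu
  have h1 : S * S⁻¹ = 1 := Matrix.mul_nonsing_inv _ hSd
  have h2 : S⁻¹ * S = 1 := Matrix.nonsing_inv_mul _ hSd
  have h1' : S⁻¹ᵀ * Sᵀ = 1 := by rw [← Matrix.transpose_mul, h1, Matrix.transpose_one]
  have h2' : Sᵀ * S⁻¹ᵀ = 1 := by rw [← Matrix.transpose_mul, h2, Matrix.transpose_one]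
  have hrec : ∀ c : Matrix (Fin r) (Fin r) ℂ, Sᵀ * (S⁻¹ᵀ * c * S⁻¹) * S = c := by
    intro c
    calc Sᵀ * (S⁻¹ᵀ * c * S⁻¹) * S = (Sᵀ * S⁻¹ᵀ) * c * (S⁻¹ * S) := by
          simp only [Matrix.mul_assoc]
      _ = c := by rw [h2', h2, Matrix.one_mul, Matrix.mul_one]
  have hsy : ∀ c : Matrix (Fin r) (Fin r) ℂ, c.IsSymm → (S⁻¹ᵀ * c * S⁻¹).IsSymm := by
    intro c hc
    rw [Matrix.IsSymm]
    simp only [Matrix.transpose_mul, Matrix.transpose_transpose, hc.eq, Matrix.mul_assoc]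
  set a' := S⁻¹ᵀ * a * S⁻¹ with ha'
  set b' := S⁻¹ᵀ * b * S⁻¹ with hb'
  have hd := diag4 l hl b' a' (hsy b hb)
  have hc := cov T hT _ hd.1
  rw [hd.2] at hc
  have hfun : (fun x : Fin r → ℂ => Complex.exp (-(star x ⬝ᵥ (sKer r z w *ᵥ x))) *
      ((x ⬝ᵥ (a *ᵥ x)) * (star x ⬝ᵥ (b *ᵥ star x)))) = fun x =>
      Complex.exp (-(star (S *ᵥ x) ⬝ᵥ (diagonal l *ᵥ (S *ᵥ x)))) *
      (((S *ᵥ x) ⬝ᵥ (a' *ᵥ (S *ᵥ x))) * (star (S *ᵥ x) ⬝ᵥ (b' *ᵥ star (S *ᵥ x)))) := by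
    ext x
    rw [hS, star_map_mulVec, ← hS, ← quad_conj, ← quad_conj, ← quad_conj, ha', hb', hrec, hrec, hu]
  rw [hfun]
  refine ⟨hc.1, hc.2.trans ?_⟩
  have hinv : (sKer r z w)⁻¹ = S⁻¹ * diagonal (fun k => (l k)⁻¹) * S⁻¹ᵀ := by
    apply Matrix.inv_eq_right_inv
    rw [hu]
    calc Sᵀ * diagonal l * S * (S⁻¹ * diagonal (fun k => (l k)⁻¹) * S⁻¹ᵀ)
        = Sᵀ * (diagonal l * (S * S⁻¹) * diagonal (fun k => (l k)⁻¹)) * S⁻¹ᵀ := by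
          simp only [Matrix.mul_assoc]
      _ = 1 := by
          rw [h1, Matrix.mul_one, Matrix.diagonal_mul_diagonal]
          simp only [mul_inv_cancel₀ (hl0 _), Matrix.diagonal_one, Matrix.mul_one, h2']
  have htr : ((sKer r z w)⁻¹ * b * (sKer r z w)⁻¹ * a).trace =
      (diagonal (fun k => (l k)⁻¹) * b' * diagonal (fun k => (l k)⁻¹) * a').trace := by
    rw [hinv, ha', hb']
    rw [show S⁻¹ * diagonal (fun k => (l k)⁻¹) * S⁻¹ᵀ * b * (S⁻¹ * diagonal (fun k => (l k)⁻¹) * S⁻¹ᵀ) * a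
      = S⁻¹ * (diagonal (fun k => (l k)⁻¹) * S⁻¹ᵀ * b * S⁻¹ * diagonal (fun k => (l k)⁻¹) * S⁻¹ᵀ * a) by
        simp only [Matrix.mul_assoc], Matrix.trace_mul_comm]
    simp only [Matrix.mul_assoc]
  have hdet : (sKer r z w).det = S.det^2 * ∏ k, l k := by
    rw [hu, Matrix.det_mul, Matrix.det_mul, Matrix.det_transpose, Matrix.det_diagonal]; ring
  rw [htr, tr_diag l b' a' (hsy a ha), hdet, mul_inv]
  push_cast
  ring

open MeasureTheory in
lemma gen0 {r : ℕ} (z w : Matrix (Fin r) (Fin r) ℂ)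
    (hz : z.IsSymm) (hzi : (z.map Complex.im).PosDef)
    (hw : w.IsSymm) (hwi : (w.map Complex.im).PosDef) :
    Integrable (fun x : Fin r → ℂ => Complex.exp (-(star x ⬝ᵥ (sKer r z w *ᵥ x)))) ∧
    ∫ x : Fin r → ℂ, Complex.exp (-(star x ⬝ᵥ (sKer r z w *ᵥ x))) =
      (Real.pi^r : ℝ) * (sKer r z w).det⁻¹ := by
  obtain ⟨T, l, hT, hl, hu⟩ := sKer_diag z w hz hzi hw hwi
  set S := T.map Complex.ofReal with hS
  have hd := moment0 l hl
  have hc := cov T hT _ hd.1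
  rw [hd.2] at hc
  have hfun : (fun x : Fin r → ℂ => Complex.exp (-(star x ⬝ᵥ (sKer r z w *ᵥ x)))) = fun x =>
      Complex.exp (-∑ k, l k * (‖(S *ᵥ x) k‖:ℂ)^2) := by
    ext x
    rw [← star_quad, hS, star_map_mulVec, ← hS, ← quad_conj, hu]
  rw [hfun]
  refine ⟨hc.1, hc.2.trans ?_⟩
  have hdet : (sKer r z w).det = S.det^2 * ∏ k, l k := by
    rw [hu, Matrix.det_mul, Matrix.det_mul, Matrix.det_transpose, Matrix.det_diagonal]; ring
  rw [hdet, mul_inv]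
  push_cast
  ring

open MeasureTheory in
/-- Gram matrices of functions are positive semidefinite. -/
lemma gram_psd {X : Type*} [MeasurableSpace X] (μ : Measure X) {N : ℕ} (f : Fin N → X → ℂ)
    (hf : ∀ i j, Integrable (fun x => f i x * starRingEnd ℂ (f j x)) μ) (c : ℝ) (hc : 0 < c)
    (G : Matrix (Fin N) (Fin N) ℂ)
    (hG : ∀ i j, ∫ x, f i x * starRingEnd ℂ (f j x) ∂μ = c * G i j) : G.PosSemidef := by
  have hG' : ∀ i j, G i j = (c:ℂ)⁻¹ * ∫ x, f i x * starRingEnd ℂ (f j x) ∂μ := by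
    intro i j
    rw [hG, inv_mul_cancel_left₀]
    exact_mod_cast hc.ne'
  rw [Matrix.posSemidef_iff_dotProduct_mulVec]
  constructor
  · ext i j
    rw [Matrix.conjTranspose_apply, hG', hG', RCLike.star_def, map_mul, ← integral_conj]
    simp [mul_comm]
  · intro y
    have h : star y ⬝ᵥ (G *ᵥ y) = (c:ℂ)⁻¹ * ∫ x, ((‖∑ i, starRingEnd ℂ (y i) * f i x‖^2 : ℝ) : ℂ) ∂μ := by
      have e : ∀ x, ((‖∑ i, starRingEnd ℂ (y i) * f i x‖^2 : ℝ) : ℂ) =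
          ∑ i, ∑ j, (starRingEnd ℂ (y i) * y j) * (f i x * starRingEnd ℂ (f j x)) := by
        intro x
        rw [← Complex.normSq_eq_norm_sq, ← Complex.mul_conj, map_sum, Finset.sum_mul_sum]
        refine Finset.sum_congr rfl fun i _ => Finset.sum_congr rfl fun j _ => ?_
        simp; ring
      simp_rw [e]
      rw [integral_finsetSum _ fun i _ => integrable_finsetSum _ fun j _ => (hf i j).const_mul _]
      simp only [dotProduct, mulVec, Finset.mul_sum, Pi.star_apply]
      refine Finset.sum_congr rfl fun i _ => ?_
      rw [integral_finsetSum _ fun j _ => (hf i j).const_mul _, Finset.mul_sum]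
      refine Finset.sum_congr rfl fun j _ => ?_
      rw [integral_const_mul, hG']
      simp; ring
    rw [h, integral_complex_ofReal, ← Complex.ofReal_inv, ← Complex.ofReal_mul]
    have : 0 ≤ ∫ x, ‖∑ i, starRingEnd ℂ (y i) * f i x‖^2 ∂μ := integral_nonneg fun x => by positivity
    exact_mod_cast mul_nonneg (inv_nonneg.mpr hc.le) this

lemma exp_split {r : ℕ} (z w : Matrix (Fin r) (Fin r) ℂ) (hw : w.IsSymm) (x : Fin r → ℂ) :
    Complex.exp ((Complex.I/2) * (star x ⬝ᵥ (z *ᵥ x))) *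
      starRingEnd ℂ (Complex.exp ((Complex.I/2) * (star x ⬝ᵥ (w *ᵥ x)))) =
    Complex.exp (-(star x ⬝ᵥ (sKer r z w *ᵥ x))) := by
  have h : starRingEnd ℂ (star x ⬝ᵥ (w *ᵥ x)) = star x ⬝ᵥ (w.map (starRingEnd ℂ) *ᵥ x) := by
    simp only [dotProduct, mulVec, map_sum, map_mul, Finset.mul_sum, Pi.star_apply, Matrix.map_apply]
    rw [Finset.sum_comm]
    refine Finset.sum_congr rfl fun i _ => Finset.sum_congr rfl fun j _ => ?_
    rw [hw.apply i j]
    simp; ring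
  rw [← Complex.exp_conj, ← Complex.exp_add, map_mul, h, sKer, Matrix.smul_mulVec, dotProduct_smul,
    Matrix.sub_mulVec, dotProduct_sub]
  congr 1
  have : (2 * Complex.I)⁻¹ = -(Complex.I/2) := by
    rw [mul_inv, Complex.inv_I]; ring
  have h3 : starRingEnd ℂ (Complex.I / 2) = -(Complex.I / 2) := by
    rw [map_div₀, Complex.conj_I, map_ofNat]; ring
  rw [this, h3, smul_eq_mul]
  ring

lemma psd0 {r N : ℕ} (z : Fin N → Matrix (Fin r) (Fin r) ℂ)
    (hz : ∀ i, (z i).IsSymm) (hzi : ∀ i, ((z i).map Complex.im).PosDef) :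
    (Matrix.of fun i j => (sKer r (z i) (z j)).det⁻¹).PosSemidef := by
  refine gram_psd MeasureTheory.volume
    (fun i (x : Fin r → ℂ) => Complex.exp ((Complex.I/2) * (star x ⬝ᵥ (z i *ᵥ x))))
    (fun i j => ?_) (Real.pi^r) (by positivity) _ (fun i j => ?_)
  · simp_rw [exp_split _ _ (hz j)]
    exact (gen0 _ _ (hz i) (hzi i) (hz j) (hzi j)).1
  · simp_rw [exp_split _ _ (hz j)]
    exact (gen0 _ _ (hz i) (hzi i) (hz j) (hzi j)).2

lemma psd1 {r N : ℕ} (z : Fin N → Matrix (Fin r) (Fin r) ℂ)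
    (hz : ∀ i, (z i).IsSymm) (hzi : ∀ i, ((z i).map Complex.im).PosDef)
    (v : Fin N → Matrix (Fin r) (Fin r) ℂ) (hv : ∀ i, (v i).IsSymm) :
    (Matrix.of fun i j => (sKer r (z i) (z j)).det⁻¹ * 
      ((sKer r (z i) (z j))⁻¹ * v j * (sKer r (z i) (z j))⁻¹ *
              (v i).map (starRingEnd ℂ)).trace).PosSemidef := by
  have hv' : ∀ i, ((v i).map (starRingEnd ℂ)).IsSymm := fun i => (hv i).map _
  have key : ∀ i j (x : Fin r → ℂ), 
    (Complex.exp ((Complex.I/2) * (star x ⬝ᵥ (z i *ᵥ x))) * (x ⬝ᵥ ((v i).map (starRingEnd ℂ) *ᵥ x))) *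
    starRingEnd ℂ (Complex.exp ((Complex.I/2) * (star x ⬝ᵥ (z j *ᵥ x))) * (x ⬝ᵥ ((v j).map (starRingEnd ℂ) *ᵥ x)))
     = Complex.exp (-(star x ⬝ᵥ (sKer r (z i) (z j) *ᵥ x))) *
      ((x ⬝ᵥ ((v i).map (starRingEnd ℂ) *ᵥ x)) * (star x ⬝ᵥ (v j *ᵥ star x))) := by
    intro i j x
    have h : starRingEnd ℂ (x ⬝ᵥ ((v j).map (starRingEnd ℂ) *ᵥ x)) = star x ⬝ᵥ (v j *ᵥ star x) := by
      simp [dotProduct, mulVec, map_sum]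
    rw [← exp_split _ _ (hz j), map_mul, h]
    ring
  refine gram_psd MeasureTheory.volume
    (fun i (x : Fin r → ℂ) => Complex.exp ((Complex.I/2) * (star x ⬝ᵥ (z i *ᵥ x))) *
      (x ⬝ᵥ ((v i).map (starRingEnd ℂ) *ᵥ x)))
    (fun i j => ?_) (2 * Real.pi^r) (by positivity) _ (fun i j => ?_)
  · simp_rw [key]
    exact (gen4 _ _ (hz i) (hzi i) (hz j) (hzi j) _ _ (hv' i) (hv j)).1
  · simp_rw [key]
    exact (gen4 _ _ (hz i) (hzi i) (hz j) (hzi j) _ _ (hv' i) (hv j)).2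

lemma psdm {r N : ℕ} (z : Fin N → Matrix (Fin r) (Fin r) ℂ)
    (hz : ∀ i, (z i).IsSymm) (hzi : ∀ i, ((z i).map Complex.im).PosDef)
    (v : Fin N → Matrix (Fin r) (Fin r) ℂ) (hv : ∀ i, (v i).IsSymm) (m : ℕ) :
    (Matrix.of fun i j => ((sKer r (z i) (z j)).det⁻¹)^(m+1) * 
      ((sKer r (z i) (z j))⁻¹ * v j * (sKer r (z i) (z j))⁻¹ *
              (v i).map (starRingEnd ℂ)).trace).PosSemidef := by
  induction m with
  | zero => simpa using psd1 z hz hzi v hv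
  | succ m ih =>
    have := (psd0 z hz hzi).hadamard ih
    have e : (Matrix.of fun i j => ((sKer r (z i) (z j)).det⁻¹)^(m+1+1) *
      ((sKer r (z i) (z j))⁻¹ * v j * (sKer r (z i) (z j))⁻¹ *
              (v i).map (starRingEnd ℂ)).trace) =
      Matrix.hadamard (Matrix.of fun i j => (sKer r (z i) (z j)).det⁻¹)
       (Matrix.of fun i j => ((sKer r (z i) (z j)).det⁻¹)^(m+1) *
      ((sKer r (z i) (z j))⁻¹ * v j * (sKer r (z i) (z j))⁻¹ *
              (v i).map (starRingEnd ℂ)).trace) := by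
      ext i j
      simp only [Matrix.hadamard_apply, Matrix.of_apply]
      rw [_root_.pow_succ' _ (m+1), mul_assoc]
    rw [e]
    exact this

/-- For the Siegel upper half-space (tube over the cone of positive definite real
symmetric matrices, Jordan algebra `Sym_r(ℝ)`, rank `r`, `d = 1`), the kernel
`K_m(z,w)v = det(u(z,w))^{-m} u(z,w)⁻¹ v u(z,w)⁻¹` on symmetric matrices, with
`u(z,w) = (z - conj w)/(2i)`, is well defined (`u(z,w)` is invertible) and is
positive definite iff `m ≥ 1`. -/
theorem stmt1 (r : ℕ) (hr : 2 ≤ r) (m : ℕ) :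
    (∀ z w : Matrix (Fin r) (Fin r) ℂ,
      z.IsSymm → (z.map Complex.im).PosDef →
      w.IsSymm → (w.map Complex.im).PosDef → IsUnit (sKer r z w)) ∧
    ((∀ (N : ℕ) (z : Fin N → Matrix (Fin r) (Fin r) ℂ),
        (∀ i, (z i).IsSymm) → (∀ i, ((z i).map Complex.im).PosDef) →
        ∀ v : Fin N → Matrix (Fin r) (Fin r) ℂ, (∀ i, (v i).IsSymm) →
        0 ≤ ∑ i, ∑ j,
          ((sKer r (z i) (z j)).det ^ (-(m : ℤ)) •
            ((sKer r (z i) (z j))⁻¹ * v j * (sKer r (z i) (z j))⁻¹ *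
              (v i).map (starRingEnd ℂ))).trace) ↔
      1 ≤ m) := by
  refine ⟨fun z w hz hzi hw hwi => sKer_isUnit z w hz hzi hw hwi, ?_, ?_⟩
  · intro H
    by_contra hm
    obtain rfl : m = 0 := by omega
    obtain ⟨k, rfl⟩ : ∃ k, r = k + 2 := ⟨r - 2, by omega⟩
    exact counter k H
  · intro hm N z hz hzi v hv
    obtain ⟨n, rfl⟩ : ∃ n, m = n + 1 := ⟨m - 1, by omega⟩
    have h := (psdm z hz hzi v hv n).dotProduct_mulVec_nonneg (fun _ => 1)
    refine h.trans_eq ?_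
    simp only [dotProduct, mulVec, Pi.star_apply, star_one, one_mul, mul_one, Matrix.of_apply]
    refine Finset.sum_congr rfl fun i _ => Finset.sum_congr rfl fun j _ => ?_
    rw [Matrix.trace_smul, smul_eq_mul, _root_.zpow_neg, _root_.zpow_natCast, _root_.inv_pow]
end

section
/- Let r ≥ 2 and let c be a real symmetric r×r matrix with c² = c and rank c = 1. Let S : Sym_r(ℂ) → Sym_r(ℂ) be a ℂ-linear map that is positive semidefinite with respect to the inner product ⟨a,b⟩ = tr(a·conj(b)) (i.e. ⟨Sv,v⟩ is a nonnegative real for all v), and suppose that for every g ∈ GL(r,ℝ) with det g > 0 and g c gᵀ = c one has S v = g̃ (S(g̃ᵀ v g̃)) g̃ᵀ for all v ∈ Sym_r(ℂ), where g̃ is g viewed as a complex matrix. Then there exists a real number α ≥ 0 such that S v = α · c̃ v c̃ for all v ∈ Sym_r(ℂ), where c̃ is c viewed as a complex matrix. -/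
open Matrix
open scoped ComplexOrder

theorem aux_rank1 {r : ℕ} (c : Matrix (Fin r) (Fin r) ℝ) (h : c.rank = 1) :
    ∃ u w : Fin r → ℝ, c = vecMulVec u w := by
  rw [Matrix.rank_eq_finrank_span_cols] at h
  obtain ⟨x, hx⟩ := finrank_le_one_iff.mp h.le
  choose f hf using hx
  refine ⟨x.1, fun j => f ⟨c.col j, Submodule.subset_span ⟨j, rfl⟩⟩, ?_⟩
  ext i j
  have := congrArg (fun y => y.1 i) (hf ⟨c.col j, Submodule.subset_span ⟨j, rfl⟩⟩)
  simp only [Submodule.coe_smul, Pi.smul_apply, smul_eq_mul, Matrix.col_apply] at this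
  rw [vecMulVec_apply, ← this, mul_comm]

theorem aux_cMc {r : ℕ} (u w : Fin r → ℂ) (M : Matrix (Fin r) (Fin r) ℂ) :
    vecMulVec u w * M * vecMulVec u w = (M * vecMulVec u w).trace • vecMulVec u w := by
  rw [vecMulVec_mul, vecMulVec_mul_vecMulVec, mul_vecMulVec, trace_vecMulVec,
    vecMulVec_smul, dotProduct_comm (M *ᵥ u) w, dotProduct_mulVec]

theorem aux_det {r : ℕ} (c : Matrix (Fin r) (Fin r) ℝ) (hc : c * c = c) (s : ℝ) (hs : s ≠ 0) :
    (c + s • (1 - c)).det ≠ 0 := by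
  have h : (c + s • (1 - c)) * (c + s⁻¹ • (1 - c)) = 1 := by
    simp only [add_mul, mul_add, smul_mul_assoc, mul_smul_comm, mul_sub, sub_mul, hc, mul_one,
      one_mul, sub_self, smul_zero]
    simp [smul_smul, hs]
  intro h0
  have := congrArg det h
  rw [det_mul, h0] at this
  simp at this

/-- Let `c` be a rank-one real symmetric idempotent (`r ≥ 2`).  If a `ℂ`-linear
operator `S` on `Sym_r(ℂ)` is positive semidefinite for the inner product
`⟨a,b⟩ = tr(a·conj b)` and satisfies `S = ℓ S ℓᵗ` for every `ℓ : v ↦ g v gᵀ` in the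
stabilizer of `c` in the structure group (`g ∈ GL(r,ℝ)`, `det g > 0`,
`g c gᵀ = c`), then `S = α P(c) : v ↦ α·cvc` for some `α ≥ 0`. -/
theorem stmt16 (r : ℕ) (hr : 2 ≤ r) (c : Matrix (Fin r) (Fin r) ℝ)
    (hcsymm : c.IsSymm) (hcidem : c * c = c) (hcrank : c.rank = 1)
    (S : Matrix (Fin r) (Fin r) ℂ →ₗ[ℂ] Matrix (Fin r) (Fin r) ℂ)
    (hSsym : ∀ v : Matrix (Fin r) (Fin r) ℂ, v.IsSymm → (S v).IsSymm)
    (hSpos : ∀ v : Matrix (Fin r) (Fin r) ℂ, v.IsSymm →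
      0 ≤ (S v * v.map (starRingEnd ℂ)).trace)
    (hSinv : ∀ g : Matrix (Fin r) (Fin r) ℝ, 0 < g.det → g * c * gᵀ = c →
      ∀ v : Matrix (Fin r) (Fin r) ℂ, v.IsSymm →
        S v = g.map Complex.ofReal *
          S ((g.map Complex.ofReal)ᵀ * v * g.map Complex.ofReal) *
            (g.map Complex.ofReal)ᵀ) :
    ∃ α : ℝ, 0 ≤ α ∧ ∀ v : Matrix (Fin r) (Fin r) ℂ, v.IsSymm →
      S v = (α : ℂ) • (c.map Complex.ofReal * v * c.map Complex.ofReal) := by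
  have hDc : ∀ s : ℝ, (c + s • (1 - c)) * c = c := fun s => by simp [add_mul, sub_mul, hcidem]
  have hcD : ∀ s : ℝ, c * (c + s • (1 - c)) = c := fun s => by simp [mul_add, mul_sub, hcidem]
  have hDt : ∀ s : ℝ, (c + s • (1 - c))ᵀ = c + s • (1 - c) := fun s => by
    simp [hcsymm.eq]
  set C : Matrix (Fin r) (Fin r) ℂ := c.map Complex.ofReal with hC
  have hCt : Cᵀ = C := by rw [hC, ← transpose_map, hcsymm.eq]
  have hCC : C * C = C := by
    rw [hC]
    conv_rhs => rw [← hcidem]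
    exact (Matrix.map_mul (f := Complex.ofRealHom)).symm
  have hE : ∀ s : ℝ, ((c + s • (1 - c)) * (c + s • (1 - c))).map Complex.ofReal
      = (C + (s : ℂ) • (1 - C)) * (C + (s : ℂ) • (1 - C)) := fun s => by
    have h1 : (c + s • (1 - c)).map Complex.ofReal = C + (s : ℂ) • (1 - C) := by
      ext i j
      by_cases hij : i = j <;> simp [hC, Matrix.one_apply, hij]
    rw [← h1]
    exact Matrix.map_mul (f := Complex.ofRealHom)
  have hScont : Continuous S := LinearMap.continuous_of_finiteDimensional S
  have key : ∀ v : Matrix (Fin r) (Fin r) ℂ, v.IsSymm → S v = C * S (C * v * C) * C := by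
    intro v hv
    have hcE : Continuous (fun s : ℝ => (C + (s : ℂ) • (1 - C)) * (C + (s : ℂ) • (1 - C))) := by
      fun_prop
    have hfun := Continuous.ext_on (dense_compl_singleton (0 : ℝ))
      (f := fun _ : ℝ => S v)
      (g := fun s : ℝ => ((C + (s : ℂ) • (1 - C)) * (C + (s : ℂ) • (1 - C))) *
        S (((C + (s : ℂ) • (1 - C)) * (C + (s : ℂ) • (1 - C)))ᵀ * v *
          ((C + (s : ℂ) • (1 - C)) * (C + (s : ℂ) • (1 - C)))) *
          ((C + (s : ℂ) • (1 - C)) * (C + (s : ℂ) • (1 - C)))ᵀ)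
      continuous_const
      ((hcE.mul (hScont.comp ((hcE.matrix_transpose.mul continuous_const).mul hcE))).mul
        hcE.matrix_transpose)
      (by
        intro s hs
        have hd := aux_det c hcidem s hs
        have := hSinv ((c + s • (1 - c)) * (c + s • (1 - c)))
          (by rw [det_mul]; exact mul_self_pos.mpr hd)
          (by rw [transpose_mul, hDt, Matrix.mul_assoc _ _ c, hDc, hDc, ← Matrix.mul_assoc,
                hcD, hcD]) v hv
        rw [hE] at this
        exact this)
    have h0 := congrFun hfun 0
    simpa [hCC, hCt] using h0
  obtain ⟨u, w, huw⟩ := aux_rank1 c hcrank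
  have hCuw : C = vecMulVec (fun i => (u i : ℂ)) (fun i => (w i : ℂ)) := by
    ext i j
    simp [hC, huw, vecMulVec_apply]
  have hP : ∀ M : Matrix (Fin r) (Fin r) ℂ, C * M * C = (M * C).trace • C := by
    intro M
    rw [hCuw]
    exact aux_cMc _ _ M
  have hCconj : C.map (starRingEnd ℂ) = C := by
    ext i j
    simp [hC]
  have hpos := hSpos C hCt
  rw [hCconj] at hpos
  obtain ⟨hre, him⟩ := Complex.le_def.mp hpos
  refine ⟨(S C * C).trace.re, hre, fun v hv => ?_⟩
  have hα : (((S C * C).trace.re : ℝ) : ℂ) = (S C * C).trace :=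
    Complex.ext (by simp) (by simpa using him)
  rw [hα, key v hv, hP v, map_smul, Matrix.mul_smul, Matrix.smul_mul, hP (S C), smul_comm]
end
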